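/- Let n ≥ 4 be an integer and let Λ₀ ∈ [p(n), p_S(n)). There exist β = β(n, Λ₀) > 0, L = L(n, Λ₀) > 0 and C = C(n, Λ₀) > 0 with the following property: for every C² function f : (0,∞) → ℝ with f(t) > 0 for all t > 0, inf_{t>0} t f'(t)/f(t) ≥ 1, sup_{t>0} t f'(t)/f(t) ≤ Λ₀, and t ↦ t f'(t)/f(t) non-decreasing on (0,∞), every x₀ ∈ ℝⁿ, every R > 0, every positive solution u of Δu + f(u) = 0 on B(x₀, 2R), and every ε > 0, one has sup_{B(x₀,R)} (u+ε)^{−β} ( |∇u|²/u² + f(u)/u ) ≤ C · ε^{−β} ( 1/R² + f(Lε)/ε ). -/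

import Mathlib

open Set Metric

/-- Euclidean space ℝⁿ. -/
abbrev E (n : ℕ) := EuclideanSpace ℝ (Fin n)

/-- The Laplacian of `u : ℝⁿ → ℝ`: the sum of its second partial derivatives. -/
noncomputable def lap {n : ℕ} (u : E n → ℝ) (x : E n) : ℝ :=
  ∑ i : Fin n,
    iteratedFDeriv ℝ 2 u x ![EuclideanSpace.single i 1, EuclideanSpace.single i 1]

/-- The `i`-th partial derivative. -/
noncomputable def pd {n : ℕ} (i : Fin n) (u : E n → ℝ) (x : E n) : ℝ :=
  fderiv ℝ u x (EuclideanSpace.single i 1)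

section PartialDerivatives

open Topology Filter

variable {n : ℕ} {i j : Fin n} {u v : E n → ℝ} {x : E n}

lemma Filter.EventuallyEq.pd_eq (h : u =ᶠ[𝓝 x] v) : pd i u x = pd i v x := by
  simp only [pd, h.fderiv_eq]

lemma Filter.EventuallyEq.pd (h : u =ᶠ[𝓝 x] v) : pd i u =ᶠ[𝓝 x] pd i v :=
  h.eventuallyEq_nhds.mono fun _ h' => h'.pd_eq

lemma fderiv_apply_eq_sum_pd (z : E n) : fderiv ℝ u x z = ∑ i, z i * pd i u x := by
  have hz : z = ∑ i, z i • EuclideanSpace.single i (1 : ℝ) := by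
    ext k
    simp [Finset.sum_apply, Pi.single_apply]
  conv_lhs => rw [hz]
  simp [pd]

lemma ContDiffAt.pd (h : ContDiffAt ℝ 2 u x) : ContDiffAt ℝ 1 (pd i u) x :=
  (h.fderiv_right (m := 1) (by norm_num)).clm_apply contDiffAt_const

lemma ContDiff.pd (h : ContDiff ℝ 2 u) : ContDiff ℝ 1 (pd i u) :=
  contDiff_iff_contDiffAt.2 fun _ => h.contDiffAt.pd

lemma ContDiff.continuous_pd (h : ContDiff ℝ 1 u) : Continuous (_root_.pd i u) :=
  (h.continuous_fderiv (by norm_num)).clm_apply continuous_const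

lemma pd_pd_eq (hu : ContDiffAt ℝ 2 u x) :
    pd j (pd i u) x =
      fderiv ℝ (fderiv ℝ u) x (EuclideanSpace.single j 1) (EuclideanSpace.single i 1) := by
  have h : DifferentiableAt ℝ (fderiv ℝ u) x :=
    (hu.fderiv_right (m := 1) (by norm_num)).differentiableAt (by norm_num)
  change fderiv ℝ (fun y => fderiv ℝ u y (EuclideanSpace.single i 1)) x _ = _
  rw [fderiv_clm_apply h (differentiableAt_const _)]
  simp

lemma pd_comm (hu : ContDiffAt ℝ 2 u x) : pd i (pd j u) x = pd j (pd i u) x := by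
  rw [pd_pd_eq hu, pd_pd_eq hu]
  exact hu.isSymmSndFDerivAt (by simp) _ _

lemma lap_eq_sum_pd (hu : ContDiffAt ℝ 2 u x) : lap u x = ∑ i, pd i (pd i u) x := by
  simp only [lap, iteratedFDeriv_two_apply, pd_pd_eq hu]
  rfl

lemma norm_gradient_sq (u : E n → ℝ) (x : E n) : ‖gradient u x‖ ^ 2 = ∑ i, pd i u x ^ 2 := by
  rw [EuclideanSpace.real_norm_sq_eq]
  refine Finset.sum_congr rfl fun i _ => ?_
  have h : inner ℝ (gradient u x) (EuclideanSpace.single i (1 : ℝ)) = pd i u x :=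
    inner_gradient_left
  rw [← h, EuclideanSpace.inner_single_right]
  simp

lemma pd_const_mul (c : ℝ) (hu : DifferentiableAt ℝ u x) :
    pd i (fun y => c * u y) x = c * pd i u x := by
  simp [pd, fderiv_const_mul hu]

lemma pd_mul (hu : DifferentiableAt ℝ u x) (hv : DifferentiableAt ℝ v x) :
    pd i (fun y => u y * v y) x = u x * pd i v x + v x * pd i u x := by
  simp [pd, fderiv_fun_mul hu hv]

lemma pd_add (hu : DifferentiableAt ℝ u x) (hv : DifferentiableAt ℝ v x) :
    pd i (fun y => u y + v y) x = pd i u x + pd i v x := by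
  simp [pd, fderiv_fun_add hu hv]

lemma pd_sub (hu : DifferentiableAt ℝ u x) (hv : DifferentiableAt ℝ v x) :
    pd i (fun y => u y - v y) x = pd i u x - pd i v x := by
  simp [pd, fderiv_fun_sub hu hv]

lemma pd_sum {ι : Type*} {s : Finset ι} {F : ι → E n → ℝ}
    (hF : ∀ k ∈ s, DifferentiableAt ℝ (F k) x) :
    pd i (fun y => ∑ k ∈ s, F k y) x = ∑ k ∈ s, pd i (F k) x := by
  simp [pd, fderiv_fun_sum hF]

lemma pd_comp {φ : ℝ → ℝ} (hφ : DifferentiableAt ℝ φ (u x)) (hu : DifferentiableAt ℝ u x) :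
    pd i (fun y => φ (u y)) x = deriv φ (u x) * pd i u x := by
  have h := hφ.hasDerivAt.comp_hasFDerivAt x hu.hasFDerivAt
  rw [pd, show (fun y => φ (u y)) = φ ∘ u from rfl, h.fderiv]
  simp [pd]

lemma ContDiffAt.eventually_differentiableAt (hu : ContDiffAt ℝ 2 u x) :
    ∀ᶠ y in 𝓝 x, DifferentiableAt ℝ u y :=
  (hu.eventually (by norm_num)).mono fun _ h => h.differentiableAt (by norm_num)

lemma pd_pd_sub (hu : ContDiffAt ℝ 2 u x) (hv : ContDiffAt ℝ 2 v x) :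
    pd i (pd i fun y => u y - v y) x = pd i (pd i u) x - pd i (pd i v) x := by
  have h : pd i (fun y => u y - v y) =ᶠ[𝓝 x] fun y => pd i u y - pd i v y := by
    filter_upwards [hu.eventually_differentiableAt, hv.eventually_differentiableAt] with y h1 h2
    exact pd_sub h1 h2
  rw [h.pd_eq, pd_sub (hu.pd.differentiableAt (by norm_num)) (hv.pd.differentiableAt (by norm_num))]

lemma pd_pd_mul (hu : ContDiffAt ℝ 2 u x) (hv : ContDiffAt ℝ 2 v x) :
    pd i (pd i fun y => u y * v y) x =
      u x * pd i (pd i v) x + 2 * (pd i u x * pd i v x) + v x * pd i (pd i u) x := by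
  have h : pd i (fun y => u y * v y) =ᶠ[𝓝 x] fun y => u y * pd i v y + v y * pd i u y := by
    filter_upwards [hu.eventually_differentiableAt, hv.eventually_differentiableAt] with y h1 h2
    exact pd_mul h1 h2
  have hu0 := hu.differentiableAt (by norm_num)
  have hv0 := hv.differentiableAt (by norm_num)
  have hu1 := (hu.pd (i := i)).differentiableAt (by norm_num)
  have hv1 := (hv.pd (i := i)).differentiableAt (by norm_num)
  rw [h.pd_eq, pd_add (hu0.fun_mul hv1) (hv0.fun_mul hu1), pd_mul hu0 hv1, pd_mul hv0 hu1]
  ring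

lemma pd_pd_comp {φ : ℝ → ℝ} (hφ : ContDiffAt ℝ 2 φ (u x)) (hu : ContDiffAt ℝ 2 u x) :
    pd i (pd i fun y => φ (u y)) x =
      deriv (deriv φ) (u x) * pd i u x ^ 2 + deriv φ (u x) * pd i (pd i u) x := by
  have h : pd i (fun y => φ (u y)) =ᶠ[𝓝 x] fun y => deriv φ (u y) * pd i u y := by
    have h' : ∀ᶠ y in 𝓝 x, ContDiffAt ℝ 2 φ (u y) :=
      hu.continuousAt.eventually (hφ.eventually (by norm_num))
    filter_upwards [hu.eventually_differentiableAt, h'] with y h1 h2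
    exact pd_comp (h2.differentiableAt (by norm_num)) h1
  have hu0 := hu.differentiableAt (by norm_num)
  have hu1 := (hu.pd (i := i)).differentiableAt (by norm_num)
  have hφ1 : DifferentiableAt ℝ (deriv φ) (u x) :=
    (hφ.derivWithin (m := 1) (by norm_num)).differentiableAt (by norm_num)
  rw [h.pd_eq, pd_mul (u := fun y => deriv φ (u y)) (hφ1.comp x hu0) hu1, pd_comp hφ1 hu0]
  ring

end PartialDerivatives

section Averages

open Topology Filter MeasureTheory

variable {n : ℕ} {i j : Fin n} {Ψ F : E n → ℝ} {x : E n}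

/-- A smooth radial bump supported in the closed unit ball. -/
noncomputable def radialBump (n : ℕ) (z : E n) : ℝ := expNegInvGlue (1 - ‖z‖ ^ 2)

/-- The nonnegative weight `φ` with `∇ (radialBump n) z = - φ z • z`. -/
noncomputable def radialWeight (n : ℕ) (z : E n) : ℝ := 2 * deriv expNegInvGlue (1 - ‖z‖ ^ 2)

lemma contDiff_radialBump : ContDiff ℝ 2 (radialBump n) :=
  (expNegInvGlue.contDiff (n := 2)).comp (contDiff_const.sub (contDiff_norm_sq ℝ))

lemma continuous_radialWeight : Continuous (radialWeight n) := by
  have h : Continuous (deriv expNegInvGlue) :=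
    (expNegInvGlue.contDiff (n := 1)).continuous_deriv (by norm_num)
  unfold radialWeight
  fun_prop

lemma radialWeight_nonneg (z : E n) : 0 ≤ radialWeight n z :=
  mul_nonneg (by norm_num) expNegInvGlue.monotone.deriv_nonneg

lemma radialBump_nonneg (z : E n) : 0 ≤ radialBump n z := expNegInvGlue.nonneg _

lemma pd_radialBump (z : E n) : pd i (radialBump n) z = -(z i * radialWeight n z) := by
  have h1 : HasFDerivAt (fun y : E n => 1 - ‖y‖ ^ 2) (-(2 • innerSL ℝ z)) z :=
    (hasStrictFDerivAt_norm_sq z).hasFDerivAt.const_sub 1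
  have h2 : HasDerivAt expNegInvGlue (deriv expNegInvGlue (1 - ‖z‖ ^ 2)) (1 - ‖z‖ ^ 2) :=
    ((expNegInvGlue.contDiff (n := 1)).differentiable (by norm_num) _).hasDerivAt
  have h := h2.comp_hasFDerivAt z h1
  rw [pd, show radialBump n = expNegInvGlue ∘ fun y : E n => 1 - ‖y‖ ^ 2 from rfl, h.fderiv]
  simp [radialWeight, EuclideanSpace.inner_single_right]
  ring

lemma radialBump_eq_zero {z : E n} (hz : z ∉ closedBall (0 : E n) 1) : radialBump n z = 0 := by
  rw [mem_closedBall_zero_iff, not_le] at hz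
  exact expNegInvGlue.zero_of_nonpos (by nlinarith)

lemma radialWeight_eq_zero {z : E n} (hz : z ∉ closedBall (0 : E n) 1) :
    radialWeight n z = 0 := by
  rw [mem_closedBall_zero_iff, not_le] at hz
  have h : expNegInvGlue =ᶠ[𝓝 (1 - ‖z‖ ^ 2)] fun _ => (0 : ℝ) := by
    filter_upwards [Iio_mem_nhds (show 1 - ‖z‖ ^ 2 < 0 by nlinarith)] with s hs
    exact expNegInvGlue.zero_of_nonpos (le_of_lt hs)
  rw [radialWeight, h.deriv_eq]
  simp

lemma pd_radialBump_eq_zero {z : E n} (hz : z ∉ closedBall (0 : E n) 1) :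
    pd i (radialBump n) z = 0 := by
  rw [pd_radialBump, radialWeight_eq_zero hz, mul_zero, neg_zero]

lemma integral_radialBump_pos : 0 < ∫ z, radialBump n z := by
  refine contDiff_radialBump.continuous.integral_pos_of_hasCompactSupport_nonneg_nonzero
    (HasCompactSupport.intro (isCompact_closedBall 0 1) fun z => radialBump_eq_zero)
    radialBump_nonneg (x := 0) ?_
  simp [radialBump, expNegInvGlue.pos_of_pos one_pos |>.ne']

/-- Continuous functions supported in the closed unit ball. -/
structure IsKernel (Ψ : E n → ℝ) : Prop where
  continuous : Continuous Ψ
  eq_zero : ∀ z ∉ closedBall (0 : E n) 1, Ψ z = 0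

lemma isKernel_radialBump : IsKernel (radialBump n) :=
  ⟨contDiff_radialBump.continuous, fun _ => radialBump_eq_zero⟩

lemma isKernel_radialWeight : IsKernel (radialWeight n) :=
  ⟨continuous_radialWeight, fun _ => radialWeight_eq_zero⟩

lemma isKernel_pd_radialBump : IsKernel (pd i (radialBump n)) :=
  ⟨contDiff_radialBump.pd.continuous, fun _ => pd_radialBump_eq_zero⟩

namespace IsKernel

lemma hasCompactSupport (hΨ : IsKernel Ψ) : HasCompactSupport Ψ :=
  HasCompactSupport.intro (isCompact_closedBall 0 1) hΨ.eq_zero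

lemma integrable_mul (hΨ : IsKernel Ψ) (hF : Continuous F) : Integrable fun z => Ψ z * F z :=
  (hΨ.continuous.mul hF).integrable_of_hasCompactSupport hΨ.hasCompactSupport.mul_right

lemma integral_pd_mul (hΨ : IsKernel Ψ) (hΨ1 : ContDiff ℝ 1 Ψ) (hΨ' : IsKernel (pd i Ψ))
    (hF : ContDiff ℝ 1 F) (t : ℝ) :
    ∫ z, pd i Ψ z * F (x + t • z) = -(t * ∫ z, Ψ z * pd i F (x + t • z)) := by
  have hg (z : E n) : HasFDerivAt (fun z => F (x + t • z)) (t • fderiv ℝ F (x + t • z)) z := by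
    have h1 : HasFDerivAt (fun z : E n => x + t • z) (t • ContinuousLinearMap.id ℝ (E n)) z :=
      ((hasFDerivAt_id z).const_smul t).const_add x
    have h2 := (hF.differentiable (by norm_num) (x + t • z)).hasFDerivAt.comp z h1
    exact h2.congr_fderiv (by ext y; simp)
  have hgv (z : E n) : fderiv ℝ (fun z => F (x + t • z)) z (EuclideanSpace.single i 1) =
      t * pd i F (x + t • z) := by
    rw [(hg z).fderiv]
    rfl
  have hc : Continuous fun z : E n => x + t • z := by fun_prop
  have hF' : Continuous fun z => t * pd i F (x + t • z) :=
    continuous_const.mul (hF.continuous_pd.comp hc)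
  have h := integral_mul_fderiv_eq_neg_fderiv_mul_of_integrable (μ := volume) (f := Ψ)
    (g := fun z => F (x + t • z)) (v := EuclideanSpace.single i (1 : ℝ))
    (hΨ'.integrable_mul (hF.continuous.comp hc))
    (by simpa only [hgv] using hΨ.integrable_mul hF')
    (hΨ.integrable_mul (hF.continuous.comp hc))
    (fun z _ => hΨ1.differentiable (by norm_num) z) (fun z _ => (hg z).differentiableAt)
  simp only [hgv] at h
  rw [← integral_const_mul]
  simp only [mul_left_comm t]
  rw [h, neg_neg]
  rfl

lemma tendsto_integral (hΨ : IsKernel Ψ) {q : ℝ → E n → ℝ} {q₀ : E n → ℝ} {B : ℝ}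
    (hq : ∀ t, Continuous (q t))
    (hB : ∀ᶠ t in 𝓝[>] 0, ∀ z ∈ closedBall (0 : E n) 1, |q t z| ≤ B)
    (hlim : ∀ z, Tendsto (fun t => q t z) (𝓝[>] 0) (𝓝 (q₀ z))) :
    Tendsto (fun t => ∫ z, Ψ z * q t z) (𝓝[>] 0) (𝓝 (∫ z, Ψ z * q₀ z)) := by
  refine tendsto_integral_filter_of_dominated_convergence (fun z => |Ψ z| * B)
    (.of_forall fun t => (hΨ.integrable_mul (hq t)).aestronglyMeasurable) ?_ ?_
    (.of_forall fun z => (hlim z).const_mul _)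
  · filter_upwards [hB] with t ht
    refine .of_forall fun z => ?_
    by_cases hz : z ∈ closedBall (0 : E n) 1
    · rw [norm_mul, Real.norm_eq_abs, Real.norm_eq_abs]
      exact mul_le_mul_of_nonneg_left (ht z hz) (abs_nonneg _)
    · simp [hΨ.eq_zero z hz]
  · refine (hΨ.continuous.abs.mul continuous_const).integrable_of_hasCompactSupport ?_
    exact HasCompactSupport.intro (isCompact_closedBall 0 1) fun z hz => by simp [hΨ.eq_zero z hz]

end IsKernel

lemma exists_bound_near (hF : Continuous F) (x : E n) :
    ∃ B, ∀ y ∈ closedBall x 1, |F y| ≤ B :=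
  (isCompact_closedBall x 1).exists_bound_of_continuousOn hF.continuousOn

lemma add_smul_mem_closedBall {t : ℝ} {z : E n} (hz : z ∈ closedBall (0 : E n) 1) (ht : |t| ≤ 1) :
    x + t • z ∈ closedBall x 1 := by
  rw [mem_closedBall_zero_iff] at hz
  simp only [mem_closedBall, dist_self_add_left, norm_smul, Real.norm_eq_abs]
  exact mul_le_one₀ ht (norm_nonneg _) hz

lemma eventually_abs_le_one : ∀ᶠ t in 𝓝[>] (0 : ℝ), |t| ≤ 1 := by
  filter_upwards [Ioo_mem_nhdsGT (zero_lt_one' ℝ)] with t ht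
  rw [abs_of_pos ht.1]
  exact ht.2.le

lemma IsKernel.tendsto_integral_comp (hΨ : IsKernel Ψ) (hF : Continuous F) :
    Tendsto (fun t : ℝ => ∫ z, Ψ z * F (x + t • z)) (𝓝[>] 0) (𝓝 ((∫ z, Ψ z) * F x)) := by
  obtain ⟨B, hB⟩ := exists_bound_near hF x
  rw [← integral_mul_const]
  refine hΨ.tendsto_integral (B := B) (fun t => by fun_prop) ?_ fun z => ?_
  · filter_upwards [eventually_abs_le_one] with t ht z hz using hB _ (add_smul_mem_closedBall hz ht)
  · have h : Continuous fun t : ℝ => F (x + t • z) := by fun_prop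
    simpa using (h.tendsto 0).mono_left nhdsWithin_le_nhds

lemma IsKernel.hasDerivAt_integral_comp (hΨ : IsKernel Ψ) (hF : ContDiff ℝ 1 F) {t : ℝ}
    (ht : |t| < 1) :
    HasDerivAt (fun t : ℝ => ∫ z, Ψ z * F (x + t • z))
      (∫ z, Ψ z * fderiv ℝ F (x + t • z) z) t := by
  have hF' := hF.continuous_fderiv (by norm_num)
  obtain ⟨B, hB⟩ := (isCompact_closedBall x 1).exists_bound_of_continuousOn hF'.continuousOn
  refine (hasDerivAt_integral_of_dominated_loc_of_deriv_le (s := ball 0 1)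
    (bound := fun z => |Ψ z| * B) (F' := fun t z => Ψ z * fderiv ℝ F (x + t • z) z)
    (isOpen_ball.mem_nhds (by simpa using ht)) (.of_forall fun t => ?_) ?_ ?_ ?_ ?_ ?_).2
  · exact (hΨ.integrable_mul (hF.continuous.comp (by fun_prop))).aestronglyMeasurable
  · exact hΨ.integrable_mul (hF.continuous.comp (by fun_prop))
  · exact (hΨ.integrable_mul (by fun_prop)).aestronglyMeasurable
  · refine .of_forall fun z s hs => ?_
    by_cases hz : z ∈ closedBall (0 : E n) 1
    · rw [norm_mul, Real.norm_eq_abs]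
      refine mul_le_mul_of_nonneg_left ?_ (abs_nonneg _)
      have hs' : |s| ≤ 1 := by simpa using (mem_ball_zero_iff.1 hs).le
      have h1 := hB _ (add_smul_mem_closedBall (x := x) hz hs')
      have h2 := (fderiv ℝ F (x + s • z)).le_opNorm z
      have h3 : ‖z‖ ≤ 1 := mem_closedBall_zero_iff.1 hz
      nlinarith [norm_nonneg (fderiv ℝ F (x + s • z)), norm_nonneg z]
    · simp [hΨ.eq_zero z hz]
  · refine (hΨ.continuous.abs.mul continuous_const).integrable_of_hasCompactSupport ?_
    exact HasCompactSupport.intro (isCompact_closedBall 0 1) fun z hz => by simp [hΨ.eq_zero z hz]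
  · refine .of_forall fun z s _ => ?_
    have h1 : HasDerivAt (fun s : ℝ => x + s • z) z s := by
      simpa using ((hasDerivAt_id s).smul_const z).const_add x
    exact ((hF.differentiable (by norm_num) _).hasFDerivAt.comp_hasDerivAt s h1).const_mul _

end Averages

section Touching

open Topology Filter MeasureTheory

variable {n : ℕ} {x : E n}

lemma ContDiff.tendsto_difference_quotient {v : E n → ℝ} (hv : ContDiff ℝ 1 v) (z : E n) :
    Tendsto (fun t : ℝ => (v (x + t • z) - v x) / t) (𝓝[>] 0) (𝓝 (∑ k, z k * _root_.pd k v x)) := by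
  rw [← fderiv_apply_eq_sum_pd]
  have h1 : HasDerivAt (fun s : ℝ => x + s • z) z 0 := by
    simpa using ((hasDerivAt_id (0 : ℝ)).smul_const z).const_add x
  have h0 := (hv.differentiable (by norm_num) (x + (0 : ℝ) • z)).hasFDerivAt.comp_hasDerivAt 0 h1
  have h2 := hasDerivAt_iff_tendsto_slope.1 h0
  have h3 := h2.mono_left (nhdsWithin_mono 0 fun t (ht : t ∈ Ioi (0 : ℝ)) => ne_of_gt ht)
  simp only [zero_smul, add_zero] at h3
  refine h3.congr fun t => ?_
  simp [slope_def_field]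

lemma ContDiff.exists_lipschitz_near {v : E n → ℝ} (hv : ContDiff ℝ 1 v) (x : E n) :
    ∃ B, ∀ t : ℝ, |t| ≤ 1 → ∀ z ∈ closedBall (0 : E n) 1,
      |(v (x + t • z) - v x) / t| ≤ B := by
  obtain ⟨B, hB⟩ := (isCompact_closedBall x 1).exists_bound_of_continuousOn
    (hv.continuous_fderiv (by norm_num)).continuousOn
  have hB0 : 0 ≤ B := (norm_nonneg _).trans (hB x (mem_closedBall_self zero_le_one))
  refine ⟨B, fun t ht z hz => ?_⟩
  have h := (convex_closedBall x 1).norm_image_sub_le_of_norm_fderiv_le (𝕜 := ℝ)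
    (fun y _ => hv.differentiable (by norm_num) y) hB (mem_closedBall_self zero_le_one)
    (add_smul_mem_closedBall hz ht)
  rw [add_sub_cancel_left, norm_smul, Real.norm_eq_abs, Real.norm_eq_abs] at h
  rw [abs_div]
  refine div_le_of_le_mul₀ (abs_nonneg _) hB0 (h.trans ?_)
  have hz' : ‖z‖ ≤ 1 := mem_closedBall_zero_iff.1 hz
  exact mul_le_mul_of_nonneg_left (mul_le_of_le_one_right (abs_nonneg _) hz') hB0

lemma integral_pd_radialBump_mul_coord (i k : Fin n) :
    ∫ z, pd i (radialBump n) z * z k = if i = k then -∫ z, radialBump n z else 0 := by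
  have hc : ContDiff ℝ 1 fun z : E n => z k := by fun_prop
  have h := isKernel_radialBump.integral_pd_mul (x := 0) (i := i)
    (contDiff_radialBump.of_le (by norm_num)) isKernel_pd_radialBump hc 1
  have hp (z : E n) : pd i (fun z : E n => z k) z = if i = k then 1 else 0 := by
    have : HasFDerivAt (fun z : E n => z k) (EuclideanSpace.proj k : E n →L[ℝ] ℝ) z :=
      (EuclideanSpace.proj k : E n →L[ℝ] ℝ).hasFDerivAt
    rw [pd, this.fderiv]
    simp [eq_comm]
  simp only [hp, zero_add, one_smul, one_mul] at h
  rw [h]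
  split_ifs <;> simp

lemma IsKernel.of_pd_radialBump (i j : Fin n) : IsKernel (pd j (pd i (radialBump n))) := by
  have h1 : ContDiff ℝ 1 (pd i (radialBump n)) := contDiff_radialBump.pd
  refine ⟨h1.continuous_pd, fun z hz => ?_⟩
  have h : pd i (radialBump n) =ᶠ[𝓝 z] fun _ => 0 := by
    filter_upwards [isClosed_closedBall.isOpen_compl.mem_nhds hz] with y hy
    exact pd_radialBump_eq_zero hy
  rw [h.pd_eq]
  simp [pd]

lemma integral_pd_radialBump_mul_pd_swap {v : Fin n → E n → ℝ} (hv : ∀ j, ContDiff ℝ 1 (v j))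
    (i j : Fin n) {t : ℝ} (ht : t ≠ 0) :
    ∫ z, pd i (radialBump n) z * pd j (v i) (x + t • z) =
      ∫ z, pd j (radialBump n) z * pd i (v i) (x + t • z) := by
  have h1 := (isKernel_pd_radialBump (i := i)).integral_pd_mul (x := x) (i := j)
    contDiff_radialBump.pd (.of_pd_radialBump i j) (hv i) t
  have h2 := (isKernel_pd_radialBump (i := j)).integral_pd_mul (x := x) (i := i)
    contDiff_radialBump.pd (.of_pd_radialBump j i) (hv i) t
  have h3 (z : E n) : pd j (pd i (radialBump n)) z = pd i (pd j (radialBump n)) z :=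
    pd_comm contDiff_radialBump.contDiffAt
  simp only [h3] at h1
  exact mul_left_cancel₀ ht (neg_injective (h1.symm.trans h2))

/-- The generalized Bochner inequality for a globally defined function. -/
lemma bochner_le_of_touching_global {w D Z : E n → ℝ} (hw : ContDiff ℝ 2 w) (hD : ContDiff ℝ 1 D)
    (hZ : ContDiff ℝ 2 Z) (hwD : ∀ᶠ y in 𝓝 x, ∑ i, pd i (pd i w) y = D y)
    (hle : ∀ᶠ y in 𝓝 x, ∑ i, pd i w y ^ 2 ≤ Z y) (heq : ∑ i, pd i w x ^ 2 = Z x) :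
    2 * ∑ i, ∑ j, pd i (pd j w) x ^ 2 + 2 * ∑ j, pd j w x * pd j D x ≤
      ∑ i, pd i (pd i Z) x := by
  set v : Fin n → E n → ℝ := fun j => pd j w with hvdef
  have hv (j) : ContDiff ℝ 1 (v j) := hw.pd
  have hvc (j) : Continuous (v j) := (hv j).continuous
  have hvp (i j) : Continuous (pd i (v j)) := (hv j).continuous_pd
  have hZ1 (i) : ContDiff ℝ 1 (pd i Z) := hZ.pd
  have hZp (i) : Continuous (pd i (pd i Z)) := (hZ1 i).continuous_pd
  have hDp (i) : Continuous (pd i D) := hD.continuous_pd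
  have hsymm (i j y) : pd i (v j) y = pd j (v i) y := pd_comm hw.contDiffAt
  set F : E n → ℝ := fun y => ∑ j, v j y * v j y - Z y with hF
  have hF1 : ContDiff ℝ 1 F :=
    (ContDiff.sum fun j _ => (hv j).mul (hv j)).sub (hZ.of_le (by norm_num))
  have hFp (i y) : pd i F y = 2 * ∑ j, v j y * pd i (v j) y - pd i Z y := by
    have hvd (j) : DifferentiableAt ℝ (v j) y := (hv j).differentiable (by norm_num) y
    rw [hF, pd_sub (.fun_sum fun j _ => (hvd j).fun_mul (hvd j))
      (hZ.differentiable (by norm_num) y), pd_sum fun j _ => (hvd j).fun_mul (hvd j),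
      Finset.mul_sum]
    simp only [pd_mul (hvd _) (hvd _), two_mul]
  obtain ⟨r, hr, hball⟩ := Metric.eventually_nhds_iff_ball.1 (hwD.and hle)
  set κ := ∫ z, radialBump n z with hκ
  set m : ℝ → ℝ := fun t => ∫ z, radialWeight n z * F (x + t • z) with hm
  set q : Fin n → Fin n → ℝ → E n → ℝ := fun i j t z =>
    (v j (x + t • z) - v j x) / t * pd i (v j) (x + t • z) with hq
  set k : ℝ → ℝ := fun t =>
    2 * ∑ j, v j x * (∫ z, radialBump n z * pd j D (x + t • z))
    - 2 * ∑ i, ∑ j, (∫ z, pd i (radialBump n) z * q i j t z)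
    - ∑ i, (∫ z, radialBump n z * pd i (pd i Z) (x + t • z)) with hk
  have hqc (i j t) : Continuous (q i j t) := by
    simp only [hq]
    fun_prop
  have hball_mem {t : ℝ} (ht : |t| < r) {z : E n} (hz : z ∈ closedBall (0 : E n) 1) :
      x + t • z ∈ ball x r := by
    rw [mem_closedBall_zero_iff] at hz
    simp only [mem_ball, dist_self_add_left, norm_smul, Real.norm_eq_abs]
    nlinarith [abs_nonneg t, norm_nonneg z]
  have hderiv {t : ℝ} (ht0 : 0 < t) (ht1 : t < 1) (htr : t < r) :
      HasDerivAt m (t * k t) t := by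
    have h1 := isKernel_radialWeight.hasDerivAt_integral_comp (x := x) hF1
      (show |t| < 1 by rwa [abs_of_pos ht0])
    refine h1.congr_deriv ?_
    have htn := ht0.ne'
    have hint (i j) : Integrable fun z : E n =>
        2 * t * (pd i (radialBump n) z * q i j t z) :=
      (isKernel_pd_radialBump.integrable_mul (hqc i j t)).const_mul _
    have hint' (i j) : Integrable fun z : E n =>
        2 * v j x * (pd i (radialBump n) z * pd i (v j) (x + t • z)) :=
      (isKernel_pd_radialBump.integrable_mul (by fun_prop)).const_mul _
    have hintZ (i) : Integrable fun z : E n => pd i (radialBump n) z * pd i Z (x + t • z) :=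
      isKernel_pd_radialBump.integrable_mul ((hZ1 i).continuous.comp (by fun_prop))
    have hadd (i j) : Integrable fun z : E n => 2 * t * (pd i (radialBump n) z * q i j t z)
        + 2 * v j x * (pd i (radialBump n) z * pd i (v j) (x + t • z)) :=
      (hint i j).add (hint' i j)
    have hsum (i) : Integrable fun z : E n => ∑ j, (2 * t * (pd i (radialBump n) z * q i j t z)
        + 2 * v j x * (pd i (radialBump n) z * pd i (v j) (x + t • z))) :=
      integrable_finsetSum _ fun j _ => hadd i j
    have hsub (i) : Integrable fun z : E n => pd i (radialBump n) z * pd i Z (x + t • z) -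
        ∑ j, (2 * t * (pd i (radialBump n) z * q i j t z)
          + 2 * v j x * (pd i (radialBump n) z * pd i (v j) (x + t • z))) :=
      (hintZ i).sub (hsum i)
    have e1 (z : E n) : radialWeight n z * fderiv ℝ F (x + t • z) z =
        ∑ i, (pd i (radialBump n) z * pd i Z (x + t • z) -
          ∑ j, (2 * t * (pd i (radialBump n) z * q i j t z)
            + 2 * v j x * (pd i (radialBump n) z * pd i (v j) (x + t • z)))) := by
      rw [fderiv_apply_eq_sum_pd, Finset.mul_sum]
      refine Finset.sum_congr rfl fun i _ => ?_
      have e (j) : 2 * t * (pd i (radialBump n) z * q i j t z)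
          + 2 * v j x * (pd i (radialBump n) z * pd i (v j) (x + t • z)) =
          2 * pd i (radialBump n) z * (v j (x + t • z) * pd i (v j) (x + t • z)) := by
        simp only [hq]
        field_simp
        ring
      simp only [e]
      rw [← Finset.mul_sum, hFp, pd_radialBump]
      ring
    have e2 (j) : ∑ i, (∫ z, pd i (radialBump n) z * pd i (v j) (x + t • z)) =
        -(t * ∫ z, radialBump n z * pd j D (x + t • z)) := by
      rw [← isKernel_radialBump.integral_pd_mul (contDiff_radialBump.of_le (by norm_num))
        isKernel_pd_radialBump hD]
      calc _ = ∑ i, ∫ z, pd j (radialBump n) z * pd i (v i) (x + t • z) := by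
            refine Finset.sum_congr rfl fun i _ => ?_
            simp only [hsymm i j]
            exact integral_pd_radialBump_mul_pd_swap hv i j htn
        _ = ∫ z, ∑ i, pd j (radialBump n) z * pd i (v i) (x + t • z) :=
            (integral_finsetSum _ fun i _ =>
              isKernel_pd_radialBump.integrable_mul (by fun_prop)).symm
        _ = _ := by
            congr 1
            ext z
            by_cases hz : z ∈ closedBall (0 : E n) 1
            · rw [← Finset.mul_sum,
                (hball _ (hball_mem (by rwa [abs_of_pos ht0]) hz)).1]
            · simp [pd_radialBump_eq_zero hz]
    have e3 (i) : ∫ z, pd i (radialBump n) z * pd i Z (x + t • z) =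
        -(t * ∫ z, radialBump n z * pd i (pd i Z) (x + t • z)) :=
      isKernel_radialBump.integral_pd_mul (contDiff_radialBump.of_le (by norm_num))
        isKernel_pd_radialBump (hZ1 i) t
    have e4 (i) : ∫ z, (pd i (radialBump n) z * pd i Z (x + t • z) -
          ∑ j, (2 * t * (pd i (radialBump n) z * q i j t z)
            + 2 * v j x * (pd i (radialBump n) z * pd i (v j) (x + t • z)))) =
        -(t * ∫ z, radialBump n z * pd i (pd i Z) (x + t • z)) -
          ∑ j, (2 * t * (∫ z, pd i (radialBump n) z * q i j t z)
            + 2 * v j x * (∫ z, pd i (radialBump n) z * pd i (v j) (x + t • z))) := by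
      rw [integral_sub (hintZ i) (hsum i), e3, integral_finsetSum _ fun j _ => hadd i j]
      congr 1
      refine Finset.sum_congr rfl fun j _ => ?_
      rw [integral_add (hint i j) (hint' i j), integral_const_mul, integral_const_mul]
    simp only [e1]
    rw [integral_finsetSum _ fun i _ => hsub i]
    simp only [e4]
    simp only [Finset.sum_sub_distrib, Finset.sum_add_distrib]
    have e6 : ∑ i, ∑ j, 2 * v j x * (∫ z, pd i (radialBump n) z * pd i (v j) (x + t • z)) =
        ∑ j, 2 * v j x * -(t * ∫ z, radialBump n z * pd j D (x + t • z)) := by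
      rw [Finset.sum_comm]
      simp only [← Finset.mul_sum, e2]
    rw [e6]
    simp only [← Finset.mul_sum, Finset.sum_neg_distrib, hk]
    have e5 : ∑ j, 2 * v j x * -(t * ∫ z, radialBump n z * pd j D (x + t • z)) =
        -(2 * t * ∑ j, v j x * ∫ z, radialBump n z * pd j D (x + t • z)) := by
      rw [Finset.mul_sum, ← Finset.sum_neg_distrib]
      exact Finset.sum_congr rfl fun j _ => by ring
    rw [e5]
    ring
  have hklim : Tendsto k (𝓝[>] 0) (𝓝 (κ * (2 * ∑ j, v j x * pd j D x +
      2 * ∑ i, ∑ j, pd i (v j) x ^ 2 - ∑ i, pd i (pd i Z) x))) := by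
    have l1 (j) := (isKernel_radialBump (n := n)).tendsto_integral_comp (x := x) (hDp j)
    have l3 (i) := (isKernel_radialBump (n := n)).tendsto_integral_comp (x := x) (hZp i)
    have l2 (i j) : Tendsto (fun t => ∫ z, pd i (radialBump n) z * q i j t z) (𝓝[>] 0)
        (𝓝 (-(κ * pd i (v j) x ^ 2))) := by
      obtain ⟨B₁, hB₁⟩ := (hv j).exists_lipschitz_near x
      obtain ⟨B₂, hB₂⟩ := exists_bound_near (hvp i j) x
      have hlim (z : E n) : Tendsto (fun t => q i j t z) (𝓝[>] 0)
          (𝓝 ((∑ k, z k * pd k (v j) x) * pd i (v j) x)) := by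
        refine ((hv j).tendsto_difference_quotient z).mul ?_
        have h : Continuous fun t : ℝ => pd i (v j) (x + t • z) := by fun_prop
        simpa using (h.tendsto 0).mono_left nhdsWithin_le_nhds
      have h := isKernel_pd_radialBump.tendsto_integral (Ψ := pd i (radialBump n)) (hqc i j)
        (B := B₁ * B₂) ?_ hlim
      · convert h using 2
        have e (z : E n) : pd i (radialBump n) z * ((∑ k, z k * pd k (v j) x) * pd i (v j) x) =
            ∑ k, pd i (radialBump n) z * z k * (pd k (v j) x * pd i (v j) x) := by
          rw [Finset.sum_mul, Finset.mul_sum]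
          exact Finset.sum_congr rfl fun k _ => by ring
        simp only [e]
        rw [integral_finsetSum _ fun k _ =>
          (isKernel_pd_radialBump.integrable_mul (by fun_prop)).mul_const _]
        simp only [integral_mul_const, integral_pd_radialBump_mul_coord, ite_mul, zero_mul,
          Finset.sum_ite_eq, Finset.mem_univ, if_true]
        ring
      · filter_upwards [eventually_abs_le_one] with t ht z hz
        rw [hq, abs_mul]
        exact mul_le_mul (hB₁ t ht z hz) (hB₂ _ (add_smul_mem_closedBall hz ht)) (abs_nonneg _)
          ((abs_nonneg _).trans (hB₁ t ht z hz))
    have h := (((tendsto_finsetSum Finset.univ fun j _ => (l1 j).const_mul (v j x)).const_mul 2).sub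
      ((tendsto_finsetSum Finset.univ fun i _ =>
        tendsto_finsetSum Finset.univ fun j _ => l2 i j).const_mul 2)).sub
      (tendsto_finsetSum Finset.univ fun i _ => l3 i)
    convert h using 2
    simp only [Finset.sum_neg_distrib, ← Finset.mul_sum, mul_left_comm _ κ, ← hκ]
    ring
  have hκ0 : 0 < κ := integral_radialBump_pos
  by_contra hcon
  rw [not_le] at hcon
  have hk0 : ∀ᶠ t in 𝓝[>] (0 : ℝ), 0 < k t := by
    refine hklim.eventually (lt_mem_nhds (mul_pos hκ0 ?_))
    linarith
  obtain ⟨δ, hδ, hδk⟩ := mem_nhdsGT_iff_exists_Ioo_subset.1 hk0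
  rw [mem_Ioi] at hδ
  set T := min δ (min 1 r) with hT
  have hT0 : 0 < T := lt_min hδ (lt_min one_pos hr)
  have hTδ : T ≤ δ := min_le_left _ _
  have hT1 : T ≤ 1 := (min_le_right _ _).trans (min_le_left _ _)
  have hTr : T ≤ r := (min_le_right _ _).trans (min_le_right _ _)
  have hmono : StrictMonoOn m (Icc 0 (T / 2)) := by
    refine strictMonoOn_of_deriv_pos (convex_Icc _ _) (fun t ht => ?_) fun t ht => ?_
    · refine (isKernel_radialWeight.hasDerivAt_integral_comp (x := x) hF1
        ?_).continuousAt.continuousWithinAt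
      rw [abs_of_nonneg ht.1]
      linarith [ht.2]
    · rw [interior_Icc] at ht
      rw [(hderiv ht.1 (by linarith [ht.2]) (by linarith [ht.2])).deriv]
      exact mul_pos ht.1 (hδk ⟨ht.1, by linarith [ht.2]⟩)
  have hlt := hmono (left_mem_Icc.2 (by positivity)) (right_mem_Icc.2 (by positivity))
    (show 0 < T / 2 by positivity)
  have hm0 : m 0 = 0 := by
    have hF0 : F x = 0 := by simp only [hF, ← pow_two, hvdef, heq, sub_self]
    simp [hm, hF0]
  have hmT : m (T / 2) ≤ 0 := by
    refine integral_nonpos fun z => ?_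
    by_cases hz : z ∈ closedBall (0 : E n) 1
    · refine mul_nonpos_of_nonneg_of_nonpos (radialWeight_nonneg z) ?_
      have h := (hball _ (hball_mem (t := T / 2)
        (by rw [abs_of_pos (by positivity)]; linarith) hz)).2
      simp only [hF, ← pow_two, hvdef]
      linarith
    · simp [radialWeight_eq_zero hz]
  linarith

end Touching

section LocalTouching

open Topology Filter

variable {n : ℕ} {x : E n} {w D Z : E n → ℝ}

lemma ContDiffAt.exists_contDiff_eventuallyEq {k : ℕ} {f : E n → ℝ} (hf : ContDiffAt ℝ k f x) :
    ∃ F, ContDiff ℝ k F ∧ F =ᶠ[𝓝 x] f := by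
  obtain ⟨r, hr, hball⟩ := Metric.eventually_nhds_iff_ball.1 (hf.eventually (by simp))
  let b : ContDiffBump x := ⟨r / 3, r / 2, by positivity, by linarith⟩
  refine ⟨fun y => b y * f y, contDiff_iff_contDiffAt.2 fun y => ?_, ?_⟩
  · by_cases hy : y ∈ ball x r
    · exact b.contDiffAt.mul (hball y hy)
    · have h : y ∉ tsupport b := by
        rw [b.tsupport_eq]
        intro h
        have h' : _ ≤ r / 2 := mem_closedBall.1 h
        exact hy (mem_ball.2 (by linarith))
      have h0 : (fun y => b y * f y) =ᶠ[𝓝 y] fun _ => 0 := by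
        filter_upwards [notMem_tsupport_iff_eventuallyEq.1 h] with z hz
        simp [hz]
      exact contDiffAt_const.congr_of_eventuallyEq h0
  · filter_upwards [b.eventuallyEq_one] with y hy
    simp [hy]

/-- If `Δw = D` and `|∇w|² ≤ Z` near `x` with equality at `x`, then the Bochner formula holds as an
inequality at `x`, although `w` is only twice differentiable. -/
lemma bochner_le_of_touching (hw : ContDiffAt ℝ 2 w x) (hD : ContDiffAt ℝ 1 D x)
    (hZ : ContDiffAt ℝ 2 Z x) (hwD : ∀ᶠ y in 𝓝 x, ∑ i, pd i (pd i w) y = D y)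
    (hle : ∀ᶠ y in 𝓝 x, ∑ i, pd i w y ^ 2 ≤ Z y) (heq : ∑ i, pd i w x ^ 2 = Z x) :
    2 * ∑ i, ∑ j, pd i (pd j w) x ^ 2 + 2 * ∑ j, pd j w x * pd j D x ≤
      ∑ i, pd i (pd i Z) x := by
  obtain ⟨w', hw', hww⟩ := hw.exists_contDiff_eventuallyEq (k := 2)
  obtain ⟨D', hD', hDD⟩ := hD.exists_contDiff_eventuallyEq (k := 1)
  obtain ⟨Z', hZ', hZZ⟩ := hZ.exists_contDiff_eventuallyEq (k := 2)
  have h1 (i) : pd i w' =ᶠ[𝓝 x] pd i w := hww.pd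
  have h2 (i j) : pd i (pd j w') =ᶠ[𝓝 x] pd i (pd j w) := (h1 j).pd
  have e1 : ∀ᶠ y in 𝓝 x, ∀ i, pd i w' y = pd i w y := eventually_all.2 h1
  have e2 : ∀ᶠ y in 𝓝 x, ∀ i, pd i (pd i w') y = pd i (pd i w) y :=
    eventually_all.2 fun i => h2 i i
  have h := bochner_le_of_touching_global (x := x) hw' hD' hZ' ?_ ?_ ?_
  · simpa only [(h2 _ _).eq_of_nhds, (h1 _).eq_of_nhds, hDD.pd_eq, hZZ.pd.pd_eq] using h
  · filter_upwards [e2, hwD, hDD] with y a b c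
    simp only [a, b, c]
  · filter_upwards [e1, hle, hZZ] with y a b c
    simpa only [a, c] using b
  · simpa only [(h1 _).eq_of_nhds, hZZ.eq_of_nhds] using heq

lemma pd_eq_of_touching (hw : ContDiffAt ℝ 2 w x) (hZ : ContDiffAt ℝ 2 Z x)
    (hle : ∀ᶠ y in 𝓝 x, ∑ i, pd i w y ^ 2 ≤ Z y) (heq : ∑ i, pd i w x ^ 2 = Z x) (i : Fin n) :
    2 * ∑ j, pd j w x * pd i (pd j w) x = pd i Z x := by
  have hd (j) : DifferentiableAt ℝ (pd j w) x := hw.pd.differentiableAt (by norm_num)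
  have hZd := hZ.differentiableAt (by norm_num)
  have hs : DifferentiableAt ℝ (fun y => ∑ j, pd j w y * pd j w y) x :=
    .fun_sum fun j _ => (hd j).fun_mul (hd j)
  have hmax : IsLocalMax (fun y => ∑ j, pd j w y * pd j w y - Z y) x := by
    filter_upwards [hle] with y hy
    simp only [← pow_two]
    linarith
  have h0 : pd i (fun y => ∑ j, pd j w y * pd j w y - Z y) x = 0 := by
    rw [pd, hmax.fderiv_eq_zero]
    rfl
  rw [pd_sub hs hZd, pd_sum fun j _ => (hd j).fun_mul (hd j)] at h0
  simp only [pd_mul (hd _) (hd _), ← two_mul, ← Finset.mul_sum] at h0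
  linarith

lemma sum_sq_ge_of_sub_rank_one (A : Fin n → Fin n → ℝ) (c : Fin n → ℝ) (α γ : ℝ) :
    2 * α * (∑ i, A i i) + 2 * γ * (∑ i, ∑ j, A i j * (c i * c j)) - n * α ^ 2
      - 2 * α * γ * (∑ i, c i ^ 2) - γ ^ 2 * (∑ i, c i ^ 2) ^ 2 ≤ ∑ i, ∑ j, A i j ^ 2 := by
  have h : 0 ≤ ∑ i, ∑ j, (A i j - α * (if i = j then 1 else 0) - γ * (c i * c j)) ^ 2 := by
    positivity
  have e (i j) : (A i j - α * (if i = j then 1 else 0) - γ * (c i * c j)) ^ 2 =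
      A i j ^ 2 + (if i = j then α ^ 2 - 2 * α * A i j + 2 * α * γ * (c i * c j) else 0)
        - 2 * γ * (A i j * (c i * c j)) + γ ^ 2 * (c i ^ 2 * c j ^ 2) := by
    split_ifs <;> ring
  simp only [e, Finset.sum_add_distrib, Finset.sum_sub_distrib, Finset.sum_ite_eq,
    Finset.mem_univ, if_true, ← Finset.mul_sum, ← Finset.sum_mul, ← pow_two, Finset.sum_const,
    Finset.card_univ, Fintype.card_fin, nsmul_eq_mul] at h
  linarith

end LocalTouching

section Algebra

variable {e a m μ μ₀ b s θ y g : ℝ}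

/-- The quadratic form in `(y, g)` left over in the Bernstein argument. -/
noncomputable def bernsteinForm (a m μ b s y g : ℝ) : ℝ :=
  (2 * m * (1 + b / 2) ^ 2 - b ^ 2 / 2 - b - b * (1 - s)) * y ^ 2 +
  (b * (a * (b - μ)) + (2 + b) * (2 + a * (b - μ)) * m - 2 * (a * (b - μ)) - 2 * μ + b + a * b
    - a * b ^ 2 - a * b * (1 - s) - a * μ + a * μ ^ 2) * (g * y) +
  ((a * (b - μ)) ^ 2 / 2 + m * (2 + a * (b - μ)) ^ 2 / 2 + a * (b - μ)) * g ^ 2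

lemma bernstein_coeff_yy (hm0 : 0 < m) (hm : m * (2 + e) = e) (he : 0 < e) (hθ0 : 0 < θ)
    (hθ1 : θ ≤ 1) (hb : b = θ * e * s) :
    2 * m * (1 - θ) ≤ 2 * m * (1 + b / 2) ^ 2 - b ^ 2 / 2 - b - b * (1 - s) := by
  have h : 2 * m * (1 + b / 2) ^ 2 - b ^ 2 / 2 - b - b * (1 - s) =
      2 * m * (1 - θ) + m * (2 * θ * (1 - s) ^ 2 + θ * e * s ^ 2 * (1 - θ)) := by
    subst hb
    linear_combination (θ * s * (θ * e * s + 2 + 2 * (1 - s)) / 2) * hm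
  have h1 : 0 ≤ 1 - θ := by linarith
  rw [h]
  have : 0 ≤ m * (2 * θ * (1 - s) ^ 2 + θ * e * s ^ 2 * (1 - θ)) := by positivity
  linarith

lemma bernstein_coeff_gg (hm : m * (2 + e) = e) (he : 0 < e) (he1 : e ≤ 1)
    (ha : a * (1 + e) = 1) (hμ : μ ≤ μ₀) (hμ₀ : μ₀ ≤ 2 * e)
    (hbe : e - b ≤ (2 * e - μ₀) / 2) :
    (2 * e - μ₀) / 6 ≤
      (a * (b - μ)) ^ 2 / 2 + m * (2 + a * (b - μ)) ^ 2 / 2 + a * (b - μ) := by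
  have ha0 : 0 < a := by
    by_contra h
    nlinarith
  have h1 : (1 + m) * (a * (b - μ)) + 2 * m = 2 * (b - μ + e) / (2 + e) := by
    rw [eq_div_iff (by positivity)]
    linear_combination (a * (b - μ) + 2) * hm + 2 * (b - μ) * ha
  have h2 : (2 * e - μ₀) / 3 ≤ (1 + m) * (a * (b - μ)) + 2 * m := by
    rw [h1, le_div_iff₀ (by positivity)]
    nlinarith
  have h3 : 1 ≤ 2 + a * (b - μ) := by
    have : a * (-(2 * e)) ≤ a * (b - μ) := mul_le_mul_of_nonneg_left (by linarith) ha0.le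
    nlinarith
  have h4 : (a * (b - μ)) ^ 2 / 2 + m * (2 + a * (b - μ)) ^ 2 / 2 + a * (b - μ) =
      ((1 + m) * (a * (b - μ)) + 2 * m) * (2 + a * (b - μ)) / 2 := by ring
  rw [h4]
  nlinarith [mul_le_mul h2 h3 zero_le_one (by linarith)]

lemma bernstein_coeff_gy (hm0 : 0 < m) (hm : m * (2 + e) = e) (he : 0 < e) (he1 : e ≤ 1)
    (ha : a * (1 + e) = 1) (hb0 : 0 ≤ b) (hbe : b ≤ e) (hs : s ≤ 1) (hμ0 : 0 ≤ μ) (hμ : μ ≤ μ₀)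
    (hμ₀ : μ₀ ≤ 2 * e) (hj : e - b ≤ (2 * e - μ₀) / 14) (hs' : 1 - s ≤ (2 * e - μ₀) / 28) :
    (2 * e - μ₀) / 4 ≤
      b * (a * (b - μ)) + (2 + b) * (2 + a * (b - μ)) * m - 2 * (a * (b - μ)) - 2 * μ + b + a * b
        - a * b ^ 2 - a * b * (1 - s) - a * μ + a * μ ^ 2 := by
  have ha0 : 0 < a := by
    by_contra h
    nlinarith
  have ha1 : a ≤ 1 := by nlinarith
  have ha2 : 1 / 2 ≤ a := by nlinarith
  have hm1 : m ≤ 1 / 3 := by nlinarith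
  have hae : a * e ≤ 1 / 2 := by nlinarith
  set d := a * (e - μ) + a * e + ((2 + a * (e - μ)) + a * (2 + e)) * m - 2 * a + 1 + a
    - 2 * a * e with hd
  have key : b * (a * (b - μ)) + (2 + b) * (2 + a * (b - μ)) * m - 2 * (a * (b - μ)) - 2 * μ + b
      + a * b - a * b ^ 2 - a * b * (1 - s) - a * μ + a * μ ^ 2 =
      a * (2 * e - μ) * (1 + 2 * e - μ) - (e - b) * d + (e - b) ^ 2 * (a * m)
        - a * b * (1 - s) := by
    rw [hd]
    linear_combination (2 + a * (e - μ)) * hm + (2 * μ - 3 * e) * ha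
  have hd3 : d ≤ 3 := by
    have h1 : a * (e - μ) ≤ 1 / 2 := by nlinarith
    have h3 : ((2 + a * (e - μ)) + a * (2 + e)) * m ≤ (5 / 2 + 2) * (1 / 3) := by
      have : a * (2 + e) ≤ 2 := by nlinarith
      refine mul_le_mul (by linarith) hm1 hm0.le (by norm_num)
    nlinarith
  have h1 : (2 * e - μ₀) / 2 ≤ a * (2 * e - μ) * (1 + 2 * e - μ) := by
    have h : (2 * e - μ₀) / 2 ≤ a * (2 * e - μ) := by nlinarith
    nlinarith
  have h2 : (e - b) * d ≤ (2 * e - μ₀) / 14 * 3 := by nlinarith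
  have h3 : a * b * (1 - s) ≤ (2 * e - μ₀) / 28 := by
    have : a * b ≤ 1 := by nlinarith
    nlinarith
  have h4 : 0 ≤ (e - b) ^ 2 * (a * m) := by positivity
  rw [key]
  linarith

lemma bernsteinForm_le {h Q K E₀ p T τ : ℝ} (ha0 : 0 ≤ a) (ha1 : a ≤ 1) (hm0 : 0 ≤ m)
    (hm1 : m ≤ 1 / 3) (hb0 : 0 ≤ b) (hb1 : b ≤ 1) (hy : 0 ≤ y) (hg : 0 ≤ g)
    (hz : |a * (b - μ)| ≤ 1) (hQ : Q = y + a * g) (hK : K = b * y + a * (b - μ) * g)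
    (hT : |p| ≤ T) (hE : E₀ ≤ T * Q) (hτ : τ = (K + Q * p) / 2)
    (hh : τ ^ 2 + m * (g + y + τ) ^ 2 ≤ h)
    (hstar : 2 * h - 2 * (K * y + Q * (p * y)) - 2 * μ * g * y ≤
      Q * (E₀ + 2 * b * (p * y) - b * (g + y) + (b ^ 2 + b * (1 - s)) * y) + a * μ * g * (g + y)
        - a * μ ^ 2 * g * y) :
    bernsteinForm a m μ b s y g ≤ 9 * T * (y + g) ^ 2 := by
  have hT0 : 0 ≤ T := (abs_nonneg p).trans hT
  have hag : a * g ≤ g := mul_le_of_le_one_left hg ha1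
  have hQ0 : 0 ≤ Q := by rw [hQ]; positivity
  have hQS : Q ≤ y + g := by rw [hQ]; linarith
  have hK1 : |K| ≤ y + g := by
    rw [hK]
    refine (abs_add_le _ _).trans (add_le_add ?_ ?_)
    · rw [abs_mul, abs_of_nonneg hb0, abs_of_nonneg hy]
      exact mul_le_of_le_one_left hy hb1
    · rw [abs_mul, abs_of_nonneg hg]
      exact mul_le_of_le_one_left hg hz
  set W := 2 * (b + 1) * y - K - m * (2 * (g + y) + K) with hW
  have hWS : |W| ≤ 6 * (y + g) := by
    have hK2 := abs_le.1 hK1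
    have h1 : 0 ≤ 2 * (b + 1) * y := by positivity
    have h2 : 2 * (b + 1) * y ≤ 4 * y := by nlinarith
    have h3 : 0 ≤ m * (2 * (g + y) + K) := mul_nonneg hm0 (by linarith)
    have h4 : m * (2 * (g + y) + K) ≤ 1 / 3 * (3 * (y + g)) :=
      mul_le_mul hm1 (by linarith) (by linarith) (by norm_num)
    rw [abs_le]
    constructor <;> linarith
  have hpW : p * W ≤ T * (6 * (y + g)) := by
    refine (le_abs_self _).trans ?_
    rw [abs_mul]
    exact mul_le_mul hT hWS (abs_nonneg _) hT0
  have key : bernsteinForm a m μ b s y g ≤ Q * (E₀ + p * W) := by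
    have e : bernsteinForm a m μ b s y g = 2 * (K / 2) ^ 2 + 2 * m * (g + y + K / 2) ^ 2
        - 2 * K * y - 2 * μ * g * y
        - Q * (- b * (g + y) + (b ^ 2 + b * (1 - s)) * y) - a * μ * g * (g + y)
        + a * μ ^ 2 * g * y := by
      rw [bernsteinForm, hK, hQ]
      ring
    have hτ2 : 2 * (K / 2) ^ 2 + 2 * m * (g + y + K / 2) ^ 2 + Q * p * (K + m * (2 * (g + y) + K))
        ≤ 2 * (τ ^ 2 + m * (g + y + τ) ^ 2) := by
      have : 2 * (τ ^ 2 + m * (g + y + τ) ^ 2) = 2 * (K / 2) ^ 2 + 2 * m * (g + y + K / 2) ^ 2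
          + Q * p * (K + m * (2 * (g + y) + K)) + (1 + m) * (Q * p) ^ 2 / 2 := by
        rw [hτ]
        ring
      rw [this]
      have : 0 ≤ (1 + m) * (Q * p) ^ 2 / 2 := by positivity
      linarith
    rw [e, hW]
    linarith
  calc _ ≤ Q * (E₀ + p * W) := key
    _ ≤ Q * (T * (y + g) + T * (6 * (y + g))) := by
        refine mul_le_mul_of_nonneg_left (add_le_add (hE.trans ?_) hpW) hQ0
        exact mul_le_mul_of_nonneg_left hQS hT0
    _ ≤ (y + g) * (T * (y + g) + T * (6 * (y + g))) :=
        mul_le_mul_of_nonneg_right hQS (by positivity)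
    _ ≤ _ := by nlinarith [mul_nonneg hT0 (sq_nonneg (y + g))]

lemma bernstein_small_aux {Q K : ℝ} (ha0 : 0 ≤ a) (ha1 : a ≤ 1) (hb0 : 0 ≤ b) (hb1 : b ≤ 1)
    (hs0 : 0 ≤ s) (hs1 : s ≤ 1) (hμ0 : 0 ≤ μ) (hμ2 : μ ≤ 2) (hy : 0 ≤ y) (hg : 0 ≤ g)
    (hyg : y ≤ g) (hQ : Q = y + a * g) (hK : K = b * y + a * (b - μ) * g) :
    g ^ 2 * (a * (b - μ)) - 13 * (g * y) ≤
      -(2 * K * y) - 2 * μ * g * y - Q * (-b * (g + y) + (b ^ 2 + b * (1 - s)) * y)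
        - a * μ * g * (g + y) + a * μ ^ 2 * g * y := by
  have hgy : 0 ≤ g * y := by positivity
  have hyy : y ^ 2 ≤ g * y := by nlinarith
  have hab : a * b ≤ 1 := mul_le_one₀ ha1 hb0 hb1
  have hbs : b ^ 2 + b * (1 - s) ≤ 2 := by nlinarith
  have hbs0 : 0 ≤ b ^ 2 + b * (1 - s) := by nlinarith
  have k1 : (b ^ 2 + b * (1 - s)) * (y ^ 2 + a * (g * y)) ≤ 2 * (y ^ 2 + 1 * (g * y)) :=
    mul_le_mul hbs (by nlinarith) (by positivity) (by norm_num)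
  have k2 : b * y ^ 2 ≤ y ^ 2 := mul_le_of_le_one_left (by positivity) hb1
  have k3 : a * b * (g * y) ≤ g * y := mul_le_of_le_one_left hgy hab
  have k4 : μ * (g * y) ≤ 2 * (g * y) := mul_le_mul_of_nonneg_right hμ2 hgy
  have k5 : 0 ≤ a * μ ^ 2 * (g * y) := by positivity
  have k9 : 0 ≤ a * μ * (g * y) := by positivity
  have k10 : 0 ≤ b * (g * y) := by positivity
  have e : -(2 * K * y) - 2 * μ * g * y - Q * (-b * (g + y) + (b ^ 2 + b * (1 - s)) * y)
        - a * μ * g * (g + y) + a * μ ^ 2 * g * y =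
      g ^ 2 * (a * (b - μ)) - b * y ^ 2 - (b ^ 2 + b * (1 - s)) * (y ^ 2 + a * (g * y))
        - a * b * (g * y) + a * μ * (g * y) - 2 * (μ * (g * y)) + b * (g * y)
        + a * μ ^ 2 * (g * y) := by
    rw [hK, hQ]
    ring
  rw [e]
  linarith

/-- Small `y`: the trace part of the Hessian suffices. -/
lemma bernstein_small {N h Q K E₀ π T d : ℝ} (ha0 : 0 ≤ a) (ha1 : a ≤ 1)
    (hb0 : 0 ≤ b) (hb1 : b ≤ 1) (hs0 : 0 ≤ s) (hs1 : s ≤ 1) (hμ0 : 0 ≤ μ) (hμ2 : μ ≤ 2)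
    (hN : 0 < N) (hy : 0 ≤ y) (hg : 0 < g) (hd1 : d ≤ 2) (hT : 160 * T < d)
    (hc : d / 4 ≤ 2 / N + a * (b - μ)) (hyg : y ≤ d / 112 * g)
    (hQ : Q = y + a * g) (hK : K = b * y + a * (b - μ) * g)
    (hπ : |π| ≤ T * (y + g)) (hE : E₀ ≤ T * Q) (hh : (g + y) ^ 2 / N ≤ h)
    (hstar : 2 * h - 2 * (K * y + Q * π) - 2 * μ * g * y ≤
      Q * (E₀ + 2 * b * π - b * (g + y) + (b ^ 2 + b * (1 - s)) * y) + a * μ * g * (g + y)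
        - a * μ ^ 2 * g * y) : False := by
  have hag : a * g ≤ g := mul_le_of_le_one_left hg.le ha1
  have hag0 : 0 ≤ a * g := by positivity
  have hQ0 : 0 ≤ Q := by rw [hQ]; positivity
  have hyg' : y ≤ g := by nlinarith
  have hT0 : 0 ≤ T := nonneg_of_mul_nonneg_left ((abs_nonneg π).trans hπ) (by positivity)
  have hQS : Q ≤ 2 * g := by rw [hQ]; linarith
  have hπ' : |π| ≤ T * (2 * g) := hπ.trans (mul_le_mul_of_nonneg_left (by linarith) hT0)
  have h1 : 2 * (1 + b) * π ≤ 4 * (T * (2 * g)) := by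
    have := le_abs_self π
    have h0 := abs_nonneg π
    nlinarith
  have herr : Q * (E₀ + 2 * (1 + b) * π) ≤ 2 * g * (T * (2 * g) + 4 * (T * (2 * g))) := by
    have h2 : T * Q ≤ T * (2 * g) := mul_le_mul_of_nonneg_left hQS hT0
    have h3 : 0 ≤ T * (2 * g) := by positivity
    calc _ ≤ Q * (T * (2 * g) + 4 * (T * (2 * g))) :=
          mul_le_mul_of_nonneg_left (by linarith) hQ0
      _ ≤ _ := mul_le_mul_of_nonneg_right hQS (by linarith)
  have hh' : g ^ 2 * (2 / N) ≤ 2 * h := by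
    have : g ^ 2 / N ≤ (g + y) ^ 2 / N := by gcongr; linarith
    calc g ^ 2 * (2 / N) = 2 * (g ^ 2 / N) := by ring
      _ ≤ _ := by linarith
  have hcg : g ^ 2 * (d / 4) ≤ g ^ 2 * (2 / N + a * (b - μ)) :=
    mul_le_mul_of_nonneg_left hc (by positivity)
  have hmain := bernstein_small_aux ha0 ha1 hb0 hb1 hs0 hs1 hμ0 hμ2 hy hg.le hyg' hQ hK
  have hfin : g * y ≤ d / 112 * g ^ 2 := by nlinarith
  have hg2 : 0 < g ^ 2 := by positivity
  have hT2 : T * g ^ 2 * 160 < d * g ^ 2 := by nlinarith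
  have hd0 : 0 < d * g ^ 2 := mul_pos (by linarith) hg2
  linarith

end Algebra

section Dichotomy

variable {e a m μ μ₀ b s y g : ℝ}

lemma bernsteinForm_ge_of_dominant {c M : ℝ} (ha0 : 0 ≤ a) (ha1 : a ≤ 1) (hm0 : 0 ≤ m)
    (hb0 : 0 ≤ b) (hb1 : b ≤ 1) (hs0 : 0 ≤ s) (hμ2 : μ ≤ 2)
    (hz : |a * (b - μ)| ≤ 1) (hy : 0 ≤ y) (hg : 0 ≤ g) (hM : 1 ≤ M) (hMc : 60 ≤ M * c)
    (hyg : M * g ≤ y)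
    (hyy : 2 * c ≤ 2 * m * (1 + b / 2) ^ 2 - b ^ 2 / 2 - b - b * (1 - s)) :
    c * y ^ 2 ≤ bernsteinForm a m μ b s y g := by
  obtain ⟨hz1, hz2⟩ := abs_le.1 hz
  have hgg : -30 ≤ (a * (b - μ)) ^ 2 / 2 + m * (2 + a * (b - μ)) ^ 2 / 2 + a * (b - μ) := by
    have h1 : 0 ≤ (a * (b - μ)) ^ 2 / 2 := by positivity
    have h2 : 0 ≤ m * (2 + a * (b - μ)) ^ 2 / 2 := by positivity
    linarith
  have hgy : -30 ≤ b * (a * (b - μ)) + (2 + b) * (2 + a * (b - μ)) * m - 2 * (a * (b - μ))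
      - 2 * μ + b + a * b - a * b ^ 2 - a * b * (1 - s) - a * μ + a * μ ^ 2 := by
    have h1 : 0 ≤ (2 + b) * (2 + a * (b - μ)) * m :=
      mul_nonneg (mul_nonneg (by linarith) (by linarith)) hm0
    have h2 : 0 ≤ a * μ ^ 2 := by positivity
    have h3 : a * μ ≤ 2 := by nlinarith
    have h4 : a * b ≤ 1 := mul_le_one₀ ha1 hb0 hb1
    have h5 : 0 ≤ a * b := by positivity
    have h6 : a * b * (1 - s) ≤ 1 := by nlinarith
    have h7 : a * b ^ 2 ≤ 1 := by nlinarith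
    have h8 : -1 ≤ b * (a * (b - μ)) := by nlinarith
    linarith
  have hgy' : g ≤ y := by nlinarith
  have h1 := mul_le_mul_of_nonneg_right hyy (sq_nonneg y)
  have h2 := mul_le_mul_of_nonneg_right hgy (mul_nonneg hg hy)
  have h3 := mul_le_mul_of_nonneg_right hgg (sq_nonneg g)
  have hc0 : 0 < c := (mul_pos_iff_of_pos_left (by linarith : 0 < M)).1 (by linarith)
  have h4 : 60 * (g * y) ≤ c * y ^ 2 := by
    have h5 : 60 * g ≤ M * c * g := mul_le_mul_of_nonneg_right hMc hg
    have h6 : c * (M * g) ≤ c * y := mul_le_mul_of_nonneg_left hyg hc0.le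
    have h7 : 60 * g * y ≤ c * y * y := mul_le_mul_of_nonneg_right (by linarith) hy
    linarith
  have h8 : g * g ≤ g * y := mul_le_mul_of_nonneg_left hgy' hg
  rw [bernsteinForm]
  linarith

lemma bernsteinForm_ge_of_coeff {c : ℝ} (hc : 0 ≤ c) (hg : 0 ≤ g) (hy : 0 ≤ y)
    (hyy : 2 * c ≤ 2 * m * (1 + b / 2) ^ 2 - b ^ 2 / 2 - b - b * (1 - s))
    (hgy : 0 ≤ b * (a * (b - μ)) + (2 + b) * (2 + a * (b - μ)) * m - 2 * (a * (b - μ)) - 2 * μ + b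
      + a * b - a * b ^ 2 - a * b * (1 - s) - a * μ + a * μ ^ 2)
    (hgg : 2 * c ≤ (a * (b - μ)) ^ 2 / 2 + m * (2 + a * (b - μ)) ^ 2 / 2 + a * (b - μ)) :
    c * (y + g) ^ 2 ≤ bernsteinForm a m μ b s y g := by
  have k1 := mul_le_mul_of_nonneg_right hyy (sq_nonneg y)
  have k2 := mul_nonneg hgy (mul_nonneg hg hy)
  have k3 := mul_le_mul_of_nonneg_right hgg (sq_nonneg g)
  have k4 : 0 ≤ c * (y - g) ^ 2 := by positivity
  rw [bernsteinForm]
  linarith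

set_option maxHeartbeats 1000000 in
lemma bernstein_algebra {N : ℝ} (he : 0 < e) (he1 : e ≤ 1) (ha : a * (1 + e) = 1)
    (hN : N * e = 2 * (1 + e)) (hμ₀0 : 0 ≤ μ₀) (hμ₀ : μ₀ < 2 * e) :
    ∃ θ C : ℝ, 0 < θ ∧ θ < 1 ∧ 0 < C ∧ ∀ g y E₀ π μ s h q : ℝ, 0 < g → 0 ≤ y → 0 ≤ E₀ →
      0 ≤ μ → μ ≤ μ₀ → 0 < s → s < 1 → π ^ 2 ≤ y * E₀ →
      (∀ α γ : ℝ, 2 * α * (-(g + y)) + 2 * γ * q - N * α ^ 2 - 2 * α * γ * y - γ ^ 2 * y ^ 2 ≤ h) →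
      2 * q = (θ * e * s * (y + a * g) - a * μ * g) * y + (y + a * g) * π →
      2 * h - 2 * (μ * g * y + 2 * q) ≤
        (y + a * g) * (E₀ + 2 * (θ * e * s) * π
          + ((θ * e * s) ^ 2 + θ * e * s * (1 - s)) * y - θ * e * s * (g + y))
          - a * μ ^ 2 * g * y + a * μ * g * (g + y) →
      y + a * g ≤ C * E₀ ∨ (s < θ ∧ y + a * g ≤ C * g) := by
  have ha0 : 0 < a := by
    by_contra h
    nlinarith
  have ha1 : a ≤ 1 := by nlinarith
  have ha2 : 1 / 2 ≤ a := by nlinarith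
  have hae : a * (2 * e) ≤ 1 := by nlinarith
  have hNpos : 0 < N := by
    by_contra h
    nlinarith
  obtain ⟨m, hm⟩ : ∃ m : ℝ, m * (2 + e) = e := ⟨e / (2 + e), by field_simp⟩
  have hm0 : 0 < m := by
    by_contra h
    nlinarith
  have hm1 : m ≤ 1 / 3 := by nlinarith
  have hNm : (N - 1) * m = 1 := by
    have : ((N - 1) * m) * e = 1 * e := by linear_combination m * hN + hm
    exact mul_right_cancel₀ he.ne' this
  set d := 2 * e - μ₀ with hd
  have hd0 : 0 < d := by linarith
  have hd2 : d ≤ 2 := by linarith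
  set κ := d / 28 with hκ
  have hκ0 : 0 < κ := by positivity
  have hmκ : 0 < m * κ := by positivity
  have hmκd : m * κ ≤ d / 84 := by rw [hκ]; nlinarith
  set T := m * κ / 100 with hT
  have hT0 : 0 < T := by positivity
  set τ := T ^ 2 / (1 + 112 / d) with hτ
  have hτ0 : 0 < τ := by positivity
  have hτT : τ * (1 + 112 / d) = T ^ 2 := div_mul_cancel₀ _ (by positivity)
  have h56 : 56 ≤ 112 / d := by
    rw [le_div_iff₀ hd0]
    linarith
  have hτT1 : τ ≤ T := by
    have h1 : τ ≤ T ^ 2 := by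
      rw [← hτT]
      exact le_mul_of_one_le_right hτ0.le (by linarith)
    have h2 : T ≤ 1 := by rw [hT]; linarith
    nlinarith
  set M := 60 / (m * κ) with hM
  have hM1 : 1 ≤ M := by
    rw [hM, le_div_iff₀ hmκ]
    linarith
  have hMc : M * (m * κ) = 60 := div_mul_cancel₀ _ hmκ.ne'
  refine ⟨1 - κ, 1 / τ + M + 1, by linarith, by linarith, by positivity, ?_⟩
  clear_value τ M T κ d
  intro g y E₀ π μ s h q hg hy hE₀ hμ0 hμ hs0 hs1 hπ hh hq hstar
  rw [or_iff_not_imp_left]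
  intro hcon
  rw [not_le] at hcon
  set b := (1 - κ) * e * s with hb
  have hκ1 : 0 < 1 - κ := by linarith
  have hb0 : 0 ≤ b := by positivity
  have hbe : b ≤ e := by
    have : (1 - κ) * s ≤ 1 := mul_le_one₀ (by linarith) hs0.le hs1.le
    calc b = e * ((1 - κ) * s) := by rw [hb]; ring
      _ ≤ e := mul_le_of_le_one_right he.le this
  have hb1 : b ≤ 1 := hbe.trans he1
  have hμ2 : μ ≤ 2 := by linarith
  have hz : |a * (b - μ)| ≤ 1 := by
    rw [abs_mul, abs_of_pos ha0]
    refine le_trans (mul_le_mul_of_nonneg_left ?_ ha0.le) hae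
    rw [abs_le]
    constructor <;> linarith
  have hag : a * g ≤ g := mul_le_of_le_one_left hg.le ha1
  have hag0 : 0 ≤ a * g := by positivity
  set Q := y + a * g with hQ
  clear_value b Q
  have hQ0 : 0 < Q := by rw [hQ]; positivity
  have hEτ : E₀ ≤ τ * Q := by
    have h1 : 1 / τ * E₀ ≤ Q := by
      have : 0 ≤ (M + 1) * E₀ := by positivity
      linarith
    rwa [one_div, inv_mul_le_iff₀ hτ0] at h1
  have hET : E₀ ≤ T * Q := hEτ.trans (mul_le_mul_of_nonneg_right hτT1 hQ0.le)
  have hπτ : π ^ 2 ≤ τ * (y * (y + g)) := by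
    refine hπ.trans ((mul_le_mul_of_nonneg_left hEτ hy).trans ?_)
    have : y * (τ * Q) ≤ y * (τ * (y + g)) := by
      gcongr
      linarith
    linarith
  have hyyc := bernstein_coeff_yy hm0 hm he hκ1 (by linarith) hb
  rw [sub_sub_cancel] at hyyc
  have hform (hy0 : 0 < y) (hp : g ≤ 112 / d * y) :
      bernsteinForm a m μ b s y g ≤ 9 * T * (y + g) ^ 2 := by
    have hpT : |π| ≤ T * y := by
      refine abs_le_of_sq_le_sq (hπτ.trans ?_) (by positivity)
      have : τ * (y * (y + g)) ≤ τ * (y * (y + 112 / d * y)) := by gcongr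
      refine this.trans (le_of_eq ?_)
      linear_combination y ^ 2 * hτT
    have hpy : π / y * y = π := div_mul_cancel₀ _ hy0.ne'
    refine bernsteinForm_le (h := h) (Q := Q) (K := b * Q - a * μ * g) (E₀ := E₀) (p := π / y)
      ha0.le ha1 hm0.le hm1 hb0 hb1 hy hg.le hz hQ (by rw [hQ]; ring) ?_ hET rfl ?_ ?_
    · rwa [abs_div, abs_of_pos hy0, div_le_iff₀ hy0]
    · set t := (b * Q - a * μ * g + Q * (π / y)) / 2 with ht
      have hqt : q = t * y := by
        rw [ht]
        linear_combination hq / 2 - Q * hpy / 2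
      have hmain := hh (m * (-(g + y) - t)) ((t - m * (-(g + y) - t)) / y)
      have hγ : (t - m * (-(g + y) - t)) / y * y = t - m * (-(g + y) - t) :=
        div_mul_cancel₀ _ hy0.ne'
      set γ := (t - m * (-(g + y) - t)) / y
      refine le_trans (le_of_eq ?_) hmain
      rw [hqt]
      linear_combination (-(2 * t) + 2 * (m * (-(g + y) - t)) + (γ * y + t - m * (-(g + y) - t))) * hγ
        + m * (-(g + y) - t) ^ 2 * hNm
    · rw [hpy]
      linarith
  by_cases hsθ : s < 1 - κ
  · refine ⟨hsθ, ?_⟩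
    have hτ1 : 0 ≤ 1 / τ * g := by positivity
    by_contra hlt
    have hyM : M * g ≤ y := by linarith
    have hgy : g ≤ y := (le_mul_of_one_le_left hg.le hM1).trans hyM
    have hy0 : 0 < y := hg.trans_le hgy
    have h1 := hform hy0 (hgy.trans (le_mul_of_one_le_left hy (by linarith)))
    have h2 := bernsteinForm_ge_of_dominant (c := m * κ) ha0.le ha1 hm0.le hb0 hb1 hs0.le
      hμ2 hz hy hg.le hM1 hMc.ge hyM (by linarith)
    have h3 : (y + g) ^ 2 ≤ 4 * y ^ 2 := by
      have : (y + g) ^ 2 ≤ (2 * y) ^ 2 := by gcongr; linarith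
      linarith
    have h4 : 9 * T * (y + g) ^ 2 ≤ 9 * T * (4 * y ^ 2) :=
      mul_le_mul_of_nonneg_left h3 (by positivity)
    have h5 : 0 < m * κ * y ^ 2 := by positivity
    rw [hT] at h4 h1
    linarith
  · exfalso
    rw [not_lt] at hsθ
    clear hcon hπ
    have heb : e - b ≤ d / 14 := by
      have h1 : (1 - κ) * (1 - κ) ≤ (1 - κ) * s := mul_le_mul_of_nonneg_left hsθ hκ1.le
      have h2 : e - b = e * (1 - (1 - κ) * s) := by rw [hb]; ring
      have h3 : 1 - (1 - κ) * s ≤ 2 * κ := by linarith [sq_nonneg κ]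
      have h4 : 0 ≤ 1 - (1 - κ) * s :=
        sub_nonneg.2 (mul_le_one₀ (by linarith) hs0.le hs1.le)
      rw [h2]
      have : d / 14 = 2 * κ := by rw [hκ]; ring
      rw [this]
      exact (mul_le_of_le_one_left h4 he1).trans h3
    by_cases hyd : y ≤ d / 112 * g
    · refine bernstein_small (N := N) (h := h) (Q := Q) (K := b * Q - a * μ * g) (E₀ := E₀) (π := π)
        (T := T) (d := d) ha0.le ha1 hb0 hb1 hs0.le hs1.le hμ0 hμ2 hNpos hy hg hd2 (by linarith)
        ?_ hyd hQ (by rw [hQ]; ring) ?_ hET ?_ (by linarith)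
      · have h1 : 2 / N = a * e := by
          rw [div_eq_iff hNpos.ne']
          linear_combination -a * hN - 2 * ha
        rw [h1]
        have h2 : 1 / 2 * (d / 2) ≤ a * (e + b - μ) :=
          mul_le_mul ha2 (by linarith) (by positivity) ha0.le
        linarith
      · refine abs_le_of_sq_le_sq (hπτ.trans ?_) (by positivity)
        have h1 : τ ≤ T ^ 2 := by
          rw [← hτT]
          exact le_mul_of_one_le_right hτ0.le (by linarith)
        have h2 : y * (y + g) ≤ (y + g) ^ 2 := by
          rw [pow_two]
          exact mul_le_mul_of_nonneg_right (by linarith) (by positivity)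
        calc _ ≤ T ^ 2 * (y + g) ^ 2 := mul_le_mul h1 h2 (by positivity) (by positivity)
          _ = _ := by ring
      · refine le_trans (le_of_eq ?_) (hh (-(g + y) / N) 0)
        field_simp
        ring
    · rw [not_le] at hyd
      have hy0 : 0 < y := lt_trans (by positivity) hyd
      have h1 := hform hy0 (by
        rw [div_mul_eq_mul_div, le_div_iff₀ hd0]
        linarith)
      have hgy := bernstein_coeff_gy hm0 hm he he1 ha hb0 hbe hs1.le hμ0 hμ hμ₀.le (hd ▸ heb)
        (by linarith)
      have hgg := bernstein_coeff_gg (b := b) hm he he1 ha hμ hμ₀.le (by linarith)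
      have k4 := bernsteinForm_ge_of_coeff (c := m * κ) hmκ.le hg.le hy
        (by linarith) (hgy.trans' (by linarith)) (hgg.trans' (by linarith))
      have k8 : 0 < m * κ * (y + g) ^ 2 := by positivity
      rw [hT] at h1
      linarith

end Dichotomy

section MaximumPoint

open Topology Filter

variable {n : ℕ} {x : E n}

/-- The two consequences of the Bochner formula at a maximum point of a Bernstein-type quantity:
here `Δw = -(G(w) + |∇w|²)` and `|∇w|² + a G(w)` is touched from above by `χ Θ(w)` at `x`. -/
lemma bernstein_at_touching {w χ : E n → ℝ} {G Θ : ℝ → ℝ} {a b c E₀ : ℝ} {p : Fin n → ℝ}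
    (hw : ContDiffAt ℝ 2 w x) (hχ : ContDiffAt ℝ 2 χ x) (hG : ContDiffAt ℝ 2 G (w x))
    (hΘ : ContDiffAt ℝ 2 Θ (w x)) (hχ1 : ∀ i, pd i χ x = χ x * p i)
    (hχ2 : ∑ i, pd i (pd i χ) x = χ x * E₀) (hΘ1 : deriv Θ (w x) = b * Θ (w x))
    (hΘ2 : deriv (deriv Θ) (w x) = c * Θ (w x))
    (hwD : ∀ᶠ y in 𝓝 x, ∑ i, pd i (pd i w) y = -(G (w y) + ∑ i, pd i w y ^ 2))
    (hle : ∀ᶠ y in 𝓝 x, ∑ i, pd i w y ^ 2 ≤ χ y * Θ (w y) - a * G (w y))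
    (heq : ∑ i, pd i w x ^ 2 = χ x * Θ (w x) - a * G (w x)) :
    ∃ h q : ℝ,
      (∀ α γ : ℝ, 2 * α * (-(G (w x) + ∑ i, pd i w x ^ 2)) + 2 * γ * q - n * α ^ 2
        - 2 * α * γ * (∑ i, pd i w x ^ 2) - γ ^ 2 * (∑ i, pd i w x ^ 2) ^ 2 ≤ h) ∧
      2 * q = (b * (χ x * Θ (w x)) - a * deriv G (w x)) * (∑ i, pd i w x ^ 2)
        + χ x * Θ (w x) * ∑ i, pd i w x * p i ∧
      2 * h - 2 * (deriv G (w x) * (∑ i, pd i w x ^ 2) + 2 * q) ≤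
        χ x * Θ (w x) * (E₀ + 2 * b * (∑ i, pd i w x * p i) + c * (∑ i, pd i w x ^ 2)
          - b * (G (w x) + ∑ i, pd i w x ^ 2))
          - a * deriv (deriv G) (w x) * (∑ i, pd i w x ^ 2)
          + a * deriv G (w x) * (G (w x) + ∑ i, pd i w x ^ 2) := by
  set D : E n → ℝ := fun y => -(G (w y) + ∑ i, pd i w y ^ 2) with hDdef
  set Z : E n → ℝ := fun y => χ y * Θ (w y) - a * G (w y) with hZdef
  have hGw : ContDiffAt ℝ 2 (fun y => G (w y)) x := hG.comp x hw
  have hΘw : ContDiffAt ℝ 2 (fun y => Θ (w y)) x := hΘ.comp x hw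
  have haG : ContDiffAt ℝ 2 (fun t => a * G t) (w x) := contDiffAt_const.mul hG
  have haGw : ContDiffAt ℝ 2 (fun y => a * G (w y)) x := contDiffAt_const.mul hGw
  have hwd := hw.differentiableAt (by norm_num)
  have hwdd (i) : DifferentiableAt ℝ (pd i w) x := hw.pd.differentiableAt (by norm_num)
  have hGd := hG.differentiableAt (by norm_num)
  have hΘd := hΘ.differentiableAt (by norm_num)
  have hΘwd := hΘw.differentiableAt (by norm_num)
  have hχΘ : ContDiffAt ℝ 2 (fun y => χ y * Θ (w y)) x := hχ.mul hΘw
  have hZ : ContDiffAt ℝ 2 Z x := hχΘ.sub haGw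
  have hD : ContDiffAt ℝ 1 D x :=
    ((hGw.of_le (by norm_num)).add (ContDiffAt.sum fun i _ => (hw.pd (i := i)).pow 2)).neg
  have hbochner := bochner_le_of_touching hw hD hZ hwD hle heq
  have hfirst := pd_eq_of_touching hw hZ hle heq
  have hderiv : deriv (fun t => a * G t) = fun t => a * deriv G t := by
    ext t
    exact deriv_const_mul_field a
  have hderiv2 : deriv (fun t => a * deriv G t) = fun t => a * deriv (deriv G) t := by
    ext t
    exact deriv_const_mul_field a
  have hpdZ (i) : pd i Z x =
      χ x * Θ (w x) * p i + b * (χ x * Θ (w x)) * pd i w x - a * deriv G (w x) * pd i w x := by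
    rw [hZdef, pd_sub (hχΘ.differentiableAt (by norm_num)) (haGw.differentiableAt (by norm_num)),
      pd_mul (hχ.differentiableAt (by norm_num)) hΘwd, pd_comp hΘd hwd,
      pd_comp (φ := fun t => a * G t) (haG.differentiableAt (by norm_num)) hwd, hχ1, hΘ1, hderiv]
    ring
  have hpdZ2 (i) : pd i (pd i Z) x =
      χ x * Θ (w x) * (c * pd i w x ^ 2 + b * pd i (pd i w) x + 2 * b * (pd i w x * p i))
        + Θ (w x) * pd i (pd i χ) x
        - a * deriv (deriv G) (w x) * pd i w x ^ 2 - a * deriv G (w x) * pd i (pd i w) x := by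
    rw [hZdef, pd_pd_sub hχΘ haGw, pd_pd_mul hχ hΘw, pd_pd_comp hΘ hw, pd_comp hΘd hwd,
      pd_pd_comp (φ := fun t => a * G t) haG hw, hχ1, hΘ1, hΘ2, hderiv, hderiv2]
    ring
  have hpdD (i) : pd i D x = -(deriv G (w x) * pd i w x
      + 2 * ∑ j, pd j w x * pd i (pd j w) x) := by
    have hs : DifferentiableAt ℝ (fun y => ∑ j, pd j w y * pd j w y) x :=
      .fun_sum fun j _ => (hwdd j).fun_mul (hwdd j)
    have hGwd := hGw.differentiableAt (by norm_num)
    have e : D = fun y => (-1) * (G (w y) + ∑ j, pd j w y * pd j w y) := by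
      ext y
      simp only [hDdef, pow_two, neg_mul, one_mul]
    rw [e, pd_const_mul _ (hGwd.fun_add hs), pd_add hGwd hs, pd_comp hGd hwd,
      pd_sum fun j _ => (hwdd j).fun_mul (hwdd j), Finset.mul_sum]
    simp only [pd_mul (hwdd _) (hwdd _), two_mul]
    ring
  have hlap : ∑ i, pd i (pd i w) x = -(G (w x) + ∑ i, pd i w x ^ 2) := hwD.self_of_nhds
  have hq : 2 * ∑ i, ∑ j, pd i (pd j w) x * (pd i w x * pd j w x) =
      ∑ i, pd i w x * pd i Z x := by
    rw [Finset.mul_sum]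
    refine Finset.sum_congr rfl fun i _ => ?_
    rw [← hfirst i, Finset.mul_sum, Finset.mul_sum, Finset.mul_sum]
    exact Finset.sum_congr rfl fun j _ => by ring
  refine ⟨∑ i, ∑ j, pd i (pd j w) x ^ 2, ∑ i, ∑ j, pd i (pd j w) x * (pd i w x * pd j w x),
    fun α γ => ?_, ?_, ?_⟩
  · rw [← hlap]
    exact sum_sq_ge_of_sub_rank_one (fun i j => pd i (pd j w) x) (fun i => pd i w x) α γ
  · rw [hq]
    simp only [hpdZ]
    have e (i) : pd i w x * (χ x * Θ (w x) * p i + b * (χ x * Θ (w x)) * pd i w x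
        - a * deriv G (w x) * pd i w x) = (b * (χ x * Θ (w x)) - a * deriv G (w x)) * pd i w x ^ 2
          + χ x * Θ (w x) * (pd i w x * p i) := by ring
    simp only [e, Finset.sum_add_distrib, ← Finset.mul_sum]
  · have e1 : ∑ j, pd j w x * pd j D x = -(deriv G (w x) * (∑ i, pd i w x ^ 2)
        + 2 * ∑ i, ∑ j, pd i (pd j w) x * (pd i w x * pd j w x)) := by
      rw [hq, Finset.mul_sum, ← Finset.sum_add_distrib, ← Finset.sum_neg_distrib]
      refine Finset.sum_congr rfl fun i _ => ?_
      rw [hpdD, hfirst]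
      ring
    have e2 : ∑ i, pd i (pd i Z) x = χ x * Θ (w x) * (E₀ + 2 * b * (∑ i, pd i w x * p i)
          + c * (∑ i, pd i w x ^ 2) - b * (G (w x) + ∑ i, pd i w x ^ 2))
          - a * deriv (deriv G) (w x) * (∑ i, pd i w x ^ 2)
          + a * deriv G (w x) * (G (w x) + ∑ i, pd i w x ^ 2) := by
      simp only [hpdZ2, Finset.sum_add_distrib, Finset.sum_sub_distrib, ← Finset.mul_sum, hχ2,
        hlap]
      ring
    rw [e1, e2] at hbochner
    linarith

end MaximumPoint

section Profiles

open Topology Filter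

/-- The nonlinearity for `w = log u`: if `Δu + f(u) = 0` then `Δw = -(|∇w|² + G(w))`. -/
noncomputable def logProfile (f : ℝ → ℝ) (t : ℝ) : ℝ := f (Real.exp t) * Real.exp (-t)

lemma logProfile_log (f : ℝ → ℝ) {v : ℝ} (hv : 0 < v) : logProfile f (Real.log v) = f v / v := by
  rw [logProfile, Real.exp_log hv, Real.exp_neg, Real.exp_log hv, div_eq_mul_inv]

variable {f : ℝ → ℝ}

lemma contDiff_logProfile (hf : ContDiffOn ℝ 2 f (Ioi 0)) : ContDiff ℝ 2 (logProfile f) := by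
  have h : ContDiff ℝ 2 fun t => f (Real.exp t) :=
    contDiff_iff_contDiffAt.2 fun t =>
      (hf.contDiffAt (Ioi_mem_nhds (Real.exp_pos t))).comp t Real.contDiff_exp.contDiffAt
  exact h.mul (Real.contDiff_exp.comp contDiff_neg)

lemma logProfile_pos (hpos : ∀ t, 0 < t → 0 < f t) (t : ℝ) : 0 < logProfile f t :=
  mul_pos (hpos _ (Real.exp_pos t)) (Real.exp_pos _)

lemma deriv_logProfile (hf : ContDiffOn ℝ 2 f (Ioi 0)) (hpos : ∀ t, 0 < t → 0 < f t) (t : ℝ) :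
    deriv (logProfile f) t =
      (Real.exp t * deriv f (Real.exp t) / f (Real.exp t) - 1) * logProfile f t := by
  have h1 : HasDerivAt f (deriv f (Real.exp t)) (Real.exp t) :=
    ((hf.contDiffAt (Ioi_mem_nhds (Real.exp_pos t))).differentiableAt (by norm_num)).hasDerivAt
  have h2 := (h1.comp t (Real.hasDerivAt_exp t)).mul (hasDerivAt_neg t).exp
  have h3 : deriv (logProfile f) t = _ := h2.deriv
  have hf0 := (hpos _ (Real.exp_pos t)).ne'
  rw [h3, logProfile, Function.comp_apply]
  field_simp
  ring

lemma sq_deriv_logProfile_le (hf : ContDiffOn ℝ 2 f (Ioi 0)) (hpos : ∀ t, 0 < t → 0 < f t)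
    (hmono : ∀ s t, 0 < s → s ≤ t → s * deriv f s / f s ≤ t * deriv f t / f t) (t : ℝ) :
    deriv (logProfile f) t ^ 2 ≤ logProfile f t * deriv (deriv (logProfile f)) t := by
  have hG := contDiff_logProfile hf
  have hG0 := logProfile_pos hpos
  have hm : Monotone fun t => deriv (logProfile f) t / logProfile f t := by
    intro s t hst
    simp only [deriv_logProfile hf hpos, mul_div_cancel_right₀ _ (hG0 _).ne']
    exact sub_le_sub_right (hmono _ _ (Real.exp_pos s) (Real.exp_le_exp.2 hst)) 1
  have h1 : HasDerivAt (logProfile f) (deriv (logProfile f) t) t :=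
    (hG.differentiable (by norm_num) t).hasDerivAt
  have h2 : HasDerivAt (deriv (logProfile f)) (deriv (deriv (logProfile f)) t) t :=
    ((hG.contDiffAt.derivWithin (m := 1) (by norm_num)).differentiableAt (by norm_num)).hasDerivAt
  have h3 := hm.deriv_nonneg (x := t)
  have h4 : deriv (fun t => deriv (logProfile f) t / logProfile f t) t = _ :=
    (h2.div h1 (hG0 t).ne').deriv
  rw [h4, le_div_iff₀ (by have := hG0 t; positivity), zero_mul] at h3
  linarith

/-- The weight `(e^t + ε)^β`, whose logarithmic derivative is `β e^t / (e^t + ε)`. -/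
noncomputable def shiftedPower (ε β t : ℝ) : ℝ := (Real.exp t + ε) ^ β

variable {ε β t : ℝ}

lemma contDiff_shiftedPower (hε : 0 < ε) : ContDiff ℝ 2 (shiftedPower ε β) :=
  (Real.contDiff_exp.add contDiff_const).rpow_const_of_ne fun t => by
    have := Real.exp_pos t
    positivity

lemma hasDerivAt_shiftedPower (hε : 0 < ε) (t : ℝ) :
    HasDerivAt (shiftedPower ε β)
      (β * (Real.exp t / (Real.exp t + ε)) * shiftedPower ε β t) t := by
  have h0 : 0 < Real.exp t + ε := add_pos (Real.exp_pos t) hε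
  have h := ((Real.hasDerivAt_exp t).add_const ε).rpow_const (p := β) (Or.inl h0.ne')
  refine h.congr_deriv ?_
  rw [shiftedPower, Real.rpow_sub_one h0.ne']
  field_simp

lemma deriv_deriv_shiftedPower (hε : 0 < ε) (t : ℝ) :
    deriv (deriv (shiftedPower ε β)) t =
      ((β * (Real.exp t / (Real.exp t + ε))) ^ 2
        + β * (Real.exp t / (Real.exp t + ε)) * (1 - Real.exp t / (Real.exp t + ε)))
        * shiftedPower ε β t := by
  have h0 : 0 < Real.exp t + ε := add_pos (Real.exp_pos t) hε
  have e : deriv (shiftedPower ε β) =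
      fun t => β * (Real.exp t / (Real.exp t + ε)) * shiftedPower ε β t :=
    funext fun t => (hasDerivAt_shiftedPower hε t).deriv
  have h := ((((Real.hasDerivAt_exp t).div ((Real.hasDerivAt_exp t).add_const ε)
    h0.ne').const_mul β).mul (hasDerivAt_shiftedPower (β := β) hε t)).deriv
  rw [e]
  refine h.trans ?_
  simp only [Pi.div_apply]
  field_simp
  ring

/-- The singular weight `(r² - |y - x₀|²)⁻²`. -/
noncomputable def ballWeight {n : ℕ} (x₀ : E n) (r : ℝ) (y : E n) : ℝ :=
  ((r ^ 2 - ‖y - x₀‖ ^ 2) ^ 2)⁻¹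

lemma hasDerivAt_inv_pow_sub {c t : ℝ} (k : ℕ) (h : c - t ≠ 0) :
    HasDerivAt (fun t => ((c - t) ^ k)⁻¹) (k * ((c - t) ^ (k + 1))⁻¹) t := by
  have h1 := (((hasDerivAt_id t).const_sub c).pow k).inv (pow_ne_zero k h)
  refine h1.congr_deriv ?_
  rcases k with _ | k
  · simp
  · simp only [id, Nat.add_sub_cancel, Pi.pow_apply]
    field_simp
    ring

variable {n : ℕ} {x₀ x : E n} {r : ℝ}

lemma contDiff_norm_sub_sq : ContDiff ℝ 2 fun y : E n => ‖y - x₀‖ ^ 2 :=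
  (contDiff_id.sub contDiff_const).norm_sq ℝ

lemma pd_norm_sub_sq (i : Fin n) (y : E n) :
    pd i (fun y => ‖y - x₀‖ ^ 2) y = 2 * (y i - x₀ i) := by
  have h : HasFDerivAt (fun y : E n => ‖y - x₀‖ ^ 2) _ y :=
    ((hasFDerivAt_id y).sub_const x₀).norm_sq
  rw [pd, h.fderiv]
  simp [EuclideanSpace.inner_single_right]

lemma pd_pd_norm_sub_sq (i : Fin n) (y : E n) :
    pd i (pd i fun y => ‖y - x₀‖ ^ 2) y = 2 := by
  have e : pd i (fun y => ‖y - x₀‖ ^ 2) = fun y : E n => 2 * (y i - x₀ i) :=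
    funext (pd_norm_sub_sq i)
  have h := (((EuclideanSpace.proj i : E n →L[ℝ] ℝ).hasFDerivAt (x := y)).sub_const
    (x₀ i)).const_mul 2
  have h' : HasFDerivAt (fun y : E n => 2 * (y i - x₀ i)) _ y := h
  rw [e, pd, h'.fderiv]
  simp

lemma contDiffAt_inv_sq_sub {c t : ℝ} (h : c - t ≠ 0) :
    ContDiffAt ℝ 2 (fun t => ((c - t) ^ 2)⁻¹) t :=
  ((contDiffAt_const.sub contDiffAt_id).pow 2).inv (pow_ne_zero 2 h)

lemma contDiffAt_ballWeight (h : r ^ 2 - ‖x - x₀‖ ^ 2 ≠ 0) :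
    ContDiffAt ℝ 2 (ballWeight x₀ r) x :=
  ContDiffAt.comp (g := fun t => ((r ^ 2 - t) ^ 2)⁻¹) (f := fun y : E n => ‖y - x₀‖ ^ 2) x
    (contDiffAt_inv_sq_sub h) contDiff_norm_sub_sq.contDiffAt

lemma pd_ballWeight (h : r ^ 2 - ‖x - x₀‖ ^ 2 ≠ 0) (i : Fin n) :
    pd i (ballWeight x₀ r) x =
      ballWeight x₀ r x * (4 * (x i - x₀ i) / (r ^ 2 - ‖x - x₀‖ ^ 2)) := by
  have h1 := pd_comp (i := i) (φ := fun t => ((r ^ 2 - t) ^ 2)⁻¹)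
    (hasDerivAt_inv_pow_sub 2 h).differentiableAt
    (contDiff_norm_sub_sq.differentiable (by norm_num) x)
  rw [(hasDerivAt_inv_pow_sub 2 h).deriv, pd_norm_sub_sq] at h1
  refine h1.trans ?_
  rw [ballWeight]
  push_cast
  field_simp
  ring

lemma sum_pd_pd_ballWeight (h : r ^ 2 - ‖x - x₀‖ ^ 2 ≠ 0) :
    ∑ i, pd i (pd i (ballWeight x₀ r)) x = ballWeight x₀ r x *
      ((24 * ‖x - x₀‖ ^ 2 + 4 * n * (r ^ 2 - ‖x - x₀‖ ^ 2)) / (r ^ 2 - ‖x - x₀‖ ^ 2) ^ 2) := by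
  have h1 (i) := pd_pd_comp (i := i) (φ := fun t => ((r ^ 2 - t) ^ 2)⁻¹)
    (contDiffAt_inv_sq_sub h) (contDiff_norm_sub_sq (x₀ := x₀)).contDiffAt
  have e : deriv (fun t => ((r ^ 2 - t) ^ 2)⁻¹) =ᶠ[𝓝 (‖x - x₀‖ ^ 2)]
      fun t => 2 * ((r ^ 2 - t) ^ 3)⁻¹ := by
    have : ∀ᶠ t in 𝓝 (‖x - x₀‖ ^ 2), r ^ 2 - t ≠ 0 :=
      (continuous_const.sub continuous_id).continuousAt.eventually_ne h
    filter_upwards [this] with t ht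
    simpa using (hasDerivAt_inv_pow_sub 2 ht).deriv
  simp only [e.deriv_eq, e.eq_of_nhds, ((hasDerivAt_inv_pow_sub 3 h).const_mul 2).deriv,
    pd_norm_sub_sq, pd_pd_norm_sub_sq] at h1
  have h2 (i) : pd i (pd i (ballWeight x₀ r)) x = _ := h1 i
  have hn : ‖x - x₀‖ ^ 2 = ∑ i, (x i - x₀ i) ^ 2 := by
    rw [EuclideanSpace.real_norm_sq_eq]
    rfl
  simp only [h2, mul_pow, Finset.sum_add_distrib, ← Finset.mul_sum, ← hn, Finset.sum_const,
    Finset.card_univ, Fintype.card_fin, nsmul_eq_mul, ballWeight]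
  push_cast
  field_simp
  ring

end Profiles

section LogSolution

open Topology Filter

variable {n : ℕ} {u : E n → ℝ} {x : E n}

lemma pd_log (hu : DifferentiableAt ℝ u x) (h0 : 0 < u x) (i : Fin n) :
    pd i (fun y => Real.log (u y)) x = pd i u x / u x := by
  rw [pd_comp (Real.differentiableAt_log h0.ne') hu, Real.deriv_log, inv_mul_eq_div]

lemma sum_sq_pd_log (hu : DifferentiableAt ℝ u x) (h0 : 0 < u x) :
    ∑ i, pd i (fun y => Real.log (u y)) x ^ 2 = ‖gradient u x‖ ^ 2 / u x ^ 2 := by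
  simp only [pd_log hu h0, div_pow, norm_gradient_sq, Finset.sum_div]

lemma sum_pd_pd_log {f : ℝ → ℝ} (hu : ContDiffAt ℝ 2 u x) (h0 : 0 < u x)
    (hsol : lap u x + f (u x) = 0) :
    ∑ i, pd i (pd i fun y => Real.log (u y)) x =
      -(logProfile f (Real.log (u x)) + ∑ i, pd i (fun y => Real.log (u y)) x ^ 2) := by
  rw [lap_eq_sum_pd hu] at hsol
  have hd : deriv Real.log = fun t => t⁻¹ := Real.deriv_log'
  have h (i) : pd i (pd i fun y => Real.log (u y)) x =
      -(pd i u x / u x) ^ 2 + (u x)⁻¹ * pd i (pd i u) x := by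
    rw [pd_pd_comp (Real.contDiffAt_log.2 h0.ne') hu, hd, deriv_inv]
    field_simp
  simp only [h, Finset.sum_add_distrib, Finset.sum_neg_distrib, ← Finset.mul_sum,
    pd_log (hu.differentiableAt (by norm_num)) h0, logProfile_log f h0,
    eq_neg_of_add_eq_zero_left hsol]
  ring

/-- The alternative at an interior maximum point of
`(r² - |y - x₀|²)² (e^w + ε)^(-β) (|∇w|² + a G(w))`. -/
lemma exists_alternative_at_maximum (hn : 4 ≤ n) {Λ₀ : ℝ} (hΛ1 : 1 ≤ Λ₀)
    (hΛ2 : Λ₀ < ((n : ℝ) + 2) / ((n : ℝ) - 2)) :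
    ∃ θ C : ℝ, 0 < θ ∧ θ < 1 ∧ 0 < C ∧
      ∀ f : ℝ → ℝ, ContDiffOn ℝ 2 f (Ioi 0) →
        (∀ t : ℝ, 0 < t → 0 < f t) →
        (∀ t : ℝ, 0 < t → 1 ≤ t * deriv f t / f t) →
        (∀ t : ℝ, 0 < t → t * deriv f t / f t ≤ Λ₀) →
        (∀ s t : ℝ, 0 < s → s ≤ t → s * deriv f s / f s ≤ t * deriv f t / f t) →
        ∀ (x₀ x : E n) (r ε M : ℝ) (w : E n → ℝ), 0 < ε → ‖x - x₀‖ < r → ContDiffAt ℝ 2 w x →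
          (∀ᶠ y in 𝓝 x, ∑ i, pd i (pd i w) y = -(logProfile f (w y) + ∑ i, pd i w y ^ 2)) →
          (∀ᶠ y in 𝓝 x, ∑ i, pd i w y ^ 2 + ((n : ℝ) - 2) / n * logProfile f (w y) ≤
            ballWeight x₀ r y * (M * shiftedPower ε (θ * (2 / ((n : ℝ) - 2))) (w y))) →
          ∑ i, pd i w x ^ 2 + ((n : ℝ) - 2) / n * logProfile f (w x) =
            ballWeight x₀ r x * (M * shiftedPower ε (θ * (2 / ((n : ℝ) - 2))) (w x)) →
          ∑ i, pd i w x ^ 2 + ((n : ℝ) - 2) / n * logProfile f (w x) ≤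
              C * ((24 + 4 * n) * r ^ 2 / (r ^ 2 - ‖x - x₀‖ ^ 2) ^ 2) ∨
            Real.exp (w x) / (Real.exp (w x) + ε) < θ ∧
              ∑ i, pd i w x ^ 2 + ((n : ℝ) - 2) / n * logProfile f (w x) ≤
                C * logProfile f (w x) := by
  have hn' : (4 : ℝ) ≤ n := by exact_mod_cast hn
  have hn2 : (0 : ℝ) < (n : ℝ) - 2 := by linarith
  obtain ⟨θ, C, hθ0, hθ1, hC, H⟩ := bernstein_algebra (e := 2 / ((n : ℝ) - 2))
    (a := ((n : ℝ) - 2) / n) (μ₀ := Λ₀ - 1) (N := n) (by positivity)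
    (by rw [div_le_one hn2]; linarith) (by field_simp; ring) (by field_simp; ring)
    (by linarith) (by
      have e : ((n : ℝ) + 2) / ((n : ℝ) - 2) = 2 * (2 / ((n : ℝ) - 2)) + 1 := by
        field_simp
        ring
      linarith)
  refine ⟨θ, C, hθ0, hθ1, hC, ?_⟩
  intro f hf hpos hlow hup hmono x₀ x r ε M w hε hx hw hwD hle heq
  set G := logProfile f with hG
  set β := θ * (2 / ((n : ℝ) - 2)) with hβ
  set a := ((n : ℝ) - 2) / n with ha
  set s := Real.exp (w x) / (Real.exp (w x) + ε) with hs
  set Y := ∑ i, pd i w x ^ 2 with hY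
  set ρ := ‖x - x₀‖ with hρ
  set d := r ^ 2 - ρ ^ 2 with hd
  have hexp := Real.exp_pos (w x)
  have hρ0 : 0 ≤ ρ := norm_nonneg _
  have hd0 : 0 < d := by
    rw [hd]
    nlinarith
  have hGC := contDiff_logProfile hf
  have hG0 : 0 < G (w x) := logProfile_pos hpos _
  have hsd (t) := hasDerivAt_shiftedPower (β := β) hε t
  have hderiv : deriv (fun t => M * shiftedPower ε β t) =
      fun t => M * deriv (shiftedPower ε β) t := by
    ext t
    exact deriv_const_mul_field M
  obtain ⟨h, q, h1, h2, h3⟩ := bernstein_at_touching (a := a) (b := β * s)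
    (c := (β * s) ^ 2 + β * s * (1 - s)) (G := G) (Θ := fun t => M * shiftedPower ε β t)
    (p := fun i => 4 * (x i - x₀ i) / d) hw (contDiffAt_ballWeight hd0.ne') hGC.contDiffAt
    (contDiff_const.mul (contDiff_shiftedPower hε)).contDiffAt (pd_ballWeight hd0.ne')
    (sum_pd_pd_ballWeight hd0.ne')
    (by simp only [hderiv, (hsd _).deriv]; ring)
    (by rw [hderiv, deriv_const_mul_field, deriv_deriv_shiftedPower hε, ← hs]; ring)
    hwD (hle.mono fun y hy => by linarith) (by linarith)
  simp only [← heq] at h2 h3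
  set π := ∑ i, pd i w x * (4 * (x i - x₀ i) / d) with hπ
  have hE₀ : 0 ≤ (24 * ρ ^ 2 + 4 * n * d) / d ^ 2 := by positivity
  have hCS : π ^ 2 ≤ Y * ((24 * ρ ^ 2 + 4 * n * d) / d ^ 2) := by
    refine (Finset.sum_mul_sq_le_sq_mul_sq _ _ _).trans
      (mul_le_mul_of_nonneg_left ?_ (Finset.sum_nonneg fun i _ => sq_nonneg _))
    have e : ∑ i, (4 * (x i - x₀ i) / d) ^ 2 = 16 * ρ ^ 2 / d ^ 2 := by
      rw [hρ, EuclideanSpace.real_norm_sq_eq, Finset.mul_sum, Finset.sum_div]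
      exact Finset.sum_congr rfl fun i _ => by rw [PiLp.sub_apply, div_pow, mul_pow]; norm_num
    rw [e]
    gcongr
    nlinarith [sq_nonneg ρ]
  have hμ : deriv G (w x) =
      (Real.exp (w x) * deriv f (Real.exp (w x)) / f (Real.exp (w x)) - 1) * G (w x) :=
    deriv_logProfile hf hpos _
  set μ := Real.exp (w x) * deriv f (Real.exp (w x)) / f (Real.exp (w x)) - 1
  have hμ2 : μ ^ 2 * G (w x) ≤ deriv (deriv G) (w x) := by
    have := sq_deriv_logProfile_le hf hpos hmono (w x)
    rw [← hG, hμ] at this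
    nlinarith
  have ha0 : 0 ≤ a := by positivity
  have hY0 : 0 ≤ Y := Finset.sum_nonneg fun i _ => sq_nonneg _
  refine (H (G (w x)) Y ((24 * ρ ^ 2 + 4 * n * d) / d ^ 2) π μ s h q hG0 hY0 hE₀
    (by have := hlow _ hexp; linarith) (by have := hup _ hexp; linarith) (by positivity)
    ((div_lt_one (by positivity)).2 (by linarith)) hCS ?_ ?_ ?_).imp (fun h => h.trans ?_) id
  · exact fun α γ => le_trans (le_of_eq (by ring)) (h1 α γ)
  · rw [h2, hμ]
    ring
  · have := mul_le_mul_of_nonneg_left hμ2 (mul_nonneg ha0 hY0)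
    rw [hμ] at h3
    linarith
  · have e : 24 * ρ ^ 2 + 4 * n * d ≤ (24 + 4 * n) * r ^ 2 := by
      have : (n : ℝ) * d ≤ n * r ^ 2 :=
        mul_le_mul_of_nonneg_left (by linarith [sq_nonneg ρ]) (by linarith)
      linarith
    exact mul_le_mul_of_nonneg_left (div_le_div_of_nonneg_right e (sq_nonneg d)) hC.le

end LogSolution

section Estimate

open Topology Filter

variable {n : ℕ} {x₀ : E n} {r : ℝ}

lemma exists_weighted_maximum_mem_ball {F : E n → ℝ} (hr : 0 < r)
    (hc : ContinuousOn F (closedBall x₀ r)) (hF : ∀ y ∈ closedBall x₀ r, 0 < F y) :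
    ∃ z ∈ ball x₀ r, ∀ y ∈ closedBall x₀ r,
      (r ^ 2 - ‖y - x₀‖ ^ 2) ^ 2 * F y ≤ (r ^ 2 - ‖z - x₀‖ ^ 2) ^ 2 * F z := by
  have hc' : ContinuousOn (fun y => (r ^ 2 - ‖y - x₀‖ ^ 2) ^ 2 * F y) (closedBall x₀ r) :=
    ContinuousOn.mul (by fun_prop) hc
  have hx₀ : x₀ ∈ closedBall x₀ r := mem_closedBall_self hr.le
  obtain ⟨z, hz, hmax⟩ := (isCompact_closedBall x₀ r).exists_isMaxOn ⟨x₀, hx₀⟩ hc'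
  refine ⟨z, ?_, fun y hy => hmax hy⟩
  have h0 : 0 < (r ^ 2 - ‖x₀ - x₀‖ ^ 2) ^ 2 * F x₀ := by
    have := hF x₀ hx₀
    rw [sub_self, norm_zero, zero_pow two_ne_zero, sub_zero]
    positivity
  have h1 := h0.trans_le (hmax hx₀)
  rw [mem_closedBall, dist_eq_norm] at hz
  rw [mem_ball, dist_eq_norm]
  refine hz.lt_of_ne fun h => ?_
  simp [h] at h1

lemma monotone_logProfile {f : ℝ → ℝ} (hf : ContDiffOn ℝ 2 f (Ioi 0))
    (hpos : ∀ t, 0 < t → 0 < f t) (hlow : ∀ t : ℝ, 0 < t → 1 ≤ t * deriv f t / f t) :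
    Monotone (logProfile f) := by
  refine monotone_of_deriv_nonneg ((contDiff_logProfile hf).differentiable (by norm_num))
    fun t => ?_
  rw [deriv_logProfile hf hpos]
  exact mul_nonneg (by linarith [hlow _ (Real.exp_pos t)]) (logProfile_pos hpos t).le

/-- The maximum over a ball of the weighted Bernstein quantity. -/
lemma exists_weighted_bernstein_le (hn : 4 ≤ n) {Λ₀ : ℝ} (hΛ1 : 1 ≤ Λ₀)
    (hΛ2 : Λ₀ < ((n : ℝ) + 2) / ((n : ℝ) - 2)) :
    ∃ β L C : ℝ, 0 < β ∧ 0 < L ∧ 0 < C ∧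
      ∀ f : ℝ → ℝ, ContDiffOn ℝ 2 f (Ioi 0) →
        (∀ t : ℝ, 0 < t → 0 < f t) →
        (∀ t : ℝ, 0 < t → 1 ≤ t * deriv f t / f t) →
        (∀ t : ℝ, 0 < t → t * deriv f t / f t ≤ Λ₀) →
        (∀ s t : ℝ, 0 < s → s ≤ t → s * deriv f s / f s ≤ t * deriv f t / f t) →
        ∀ (x₀ : E n) (r : ℝ), 0 < r →
          ∀ u : E n → ℝ, (∀ x ∈ closedBall x₀ r, ContDiffAt ℝ 2 u x) →
            (∀ x ∈ closedBall x₀ r, 0 < u x) →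
            (∀ x ∈ closedBall x₀ r, lap u x + f (u x) = 0) →
            ∀ ε : ℝ, 0 < ε → ∀ x ∈ closedBall x₀ r,
              (r ^ 2 - ‖x - x₀‖ ^ 2) ^ 2 * ((u x + ε) ^ (-β) *
                (‖gradient u x‖ ^ 2 / u x ^ 2 + ((n : ℝ) - 2) / n * (f (u x) / u x)))
                ≤ C * ε ^ (-β) * ((24 + 4 * n) * r ^ 2 + r ^ 4 * (f (L * ε) / (L * ε))) := by
  have hn' : (4 : ℝ) ≤ n := by exact_mod_cast hn
  have hn2 : (0 : ℝ) < (n : ℝ) - 2 := by linarith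
  obtain ⟨θ, C, hθ0, hθ1, hC, H⟩ := exists_alternative_at_maximum hn hΛ1 hΛ2
  have hθ1' : 0 < 1 - θ := by linarith
  have hL : 0 < θ / (1 - θ) := by positivity
  have hβ : 0 < θ * (2 / ((n : ℝ) - 2)) := by positivity
  refine ⟨_, _, C, hβ, hL, hC, ?_⟩
  intro f hf hpos hlow hup hmono x₀ r hr u hu hu0 hsol ε hε
  specialize H f hf hpos hlow hup hmono x₀
  generalize θ * (2 / ((n : ℝ) - 2)) = β at *
  set a := ((n : ℝ) - 2) / n with ha
  have ha0 : 0 < a := by positivity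
  set w : E n → ℝ := fun y => Real.log (u y) with hw
  set Q : E n → ℝ := fun y => ∑ i, pd i w y ^ 2 + a * logProfile f (w y) with hQ
  have hwC (y) (hy : y ∈ closedBall x₀ r) : ContDiffAt ℝ 2 w y := (hu y hy).log (hu0 y hy).ne'
  have hQ0 (y) : 0 < Q y :=
    add_pos_of_nonneg_of_pos (Finset.sum_nonneg fun i _ => sq_nonneg _)
      (mul_pos ha0 (logProfile_pos hpos _))
  have hQeq (y) (hy : y ∈ closedBall x₀ r) :
      ‖gradient u y‖ ^ 2 / u y ^ 2 + a * (f (u y) / u y) = Q y := by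
    rw [← sum_sq_pd_log ((hu y hy).differentiableAt (by norm_num)) (hu0 y hy),
      ← logProfile_log f (hu0 y hy)]
  have hT (y) (hy : y ∈ closedBall x₀ r) : 0 < u y + ε := add_pos (hu0 y hy) hε
  have hcont : ContinuousOn (fun y => (u y + ε) ^ (-β) * Q y) (closedBall x₀ r) := by
    intro y hy
    refine ContinuousAt.continuousWithinAt (ContinuousAt.mul ?_ (ContinuousAt.add ?_ ?_))
    · exact ((hu y hy).continuousAt.add_const ε).rpow_const (Or.inl (hT y hy).ne')
    · exact tendsto_finsetSum _ fun i _ => ((hwC y hy).pd (i := i)).continuousAt.pow 2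
    · exact continuousAt_const.mul
        ((contDiff_logProfile hf).continuous.continuousAt.comp (hwC y hy).continuousAt)
  obtain ⟨z, hz, hmax⟩ := exists_weighted_maximum_mem_ball hr hcont fun y hy =>
    mul_pos (Real.rpow_pos_of_pos (hT y hy) _) (hQ0 y)
  have hz' := ball_subset_closedBall hz
  have hzr : ‖z - x₀‖ < r := by rwa [← dist_eq_norm, ← mem_ball]
  have hnhds : ∀ᶠ y in 𝓝 z, y ∈ ball x₀ r := isOpen_ball.mem_nhds hz
  have hd {y} (hy : y ∈ ball x₀ r) : 0 < r ^ 2 - ‖y - x₀‖ ^ 2 := by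
    rw [mem_ball, dist_eq_norm] at hy
    nlinarith [norm_nonneg (y - x₀)]
  have hcancel {y} (hy : y ∈ ball x₀ r) : Q y = ballWeight x₀ r y *
      ((r ^ 2 - ‖y - x₀‖ ^ 2) ^ 2 * ((u y + ε) ^ (-β) * Q y) * shiftedPower ε β (w y)) := by
    have hy' := ball_subset_closedBall hy
    have := hd hy
    have := Real.rpow_pos_of_pos (hT y hy') β
    rw [ballWeight, shiftedPower, hw, Real.exp_log (hu0 y hy'), Real.rpow_neg (hT y hy').le]
    field_simp
  have hQz := H z r ε ((r ^ 2 - ‖z - x₀‖ ^ 2) ^ 2 * ((u z + ε) ^ (-β) * Q z)) w hε hzr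
    (hwC z hz')
    (by
      filter_upwards [hnhds] with y hy
      have hy' := ball_subset_closedBall hy
      exact sum_pd_pd_log (hu y hy') (hu0 y hy') (hsol y hy'))
    (by
      filter_upwards [hnhds] with y hy
      refine (hcancel hy).le.trans (mul_le_mul_of_nonneg_left (mul_le_mul_of_nonneg_right
        (hmax y (ball_subset_closedBall hy)) ?_) (by rw [ballWeight]; positivity))
      exact Real.rpow_nonneg (add_pos (Real.exp_pos _) hε).le _)
    (hcancel hz)
  have hLε : 0 < θ / (1 - θ) * ε := mul_pos hL hε
  have hK := logProfile_pos hpos (Real.log (θ / (1 - θ) * ε))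
  have hdz := hd hz
  have key : (r ^ 2 - ‖z - x₀‖ ^ 2) ^ 2 * Q z ≤
      C * ((24 + 4 * n) * r ^ 2 + r ^ 4 * logProfile f (Real.log (θ / (1 - θ) * ε))) := by
    rcases hQz with h | ⟨h1, h2⟩
    · have h3 := mul_le_mul_of_nonneg_left h (sq_nonneg (r ^ 2 - ‖z - x₀‖ ^ 2))
      refine h3.trans ?_
      have e : (r ^ 2 - ‖z - x₀‖ ^ 2) ^ 2 *
          (C * ((24 + 4 * n) * r ^ 2 / (r ^ 2 - ‖z - x₀‖ ^ 2) ^ 2)) =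
          C * ((24 + 4 * n) * r ^ 2) := by
        field_simp
      rw [e]
      have : 0 ≤ r ^ 4 * logProfile f (Real.log (θ / (1 - θ) * ε)) := by positivity
      exact mul_le_mul_of_nonneg_left (by linarith) hC.le
    · have hz0 := hu0 z hz'
      simp only [hw, Real.exp_log hz0] at h1
      rw [div_lt_iff₀ (hT z hz')] at h1
      have hle : u z ≤ θ / (1 - θ) * ε := by
        rw [div_mul_eq_mul_div, le_div_iff₀ hθ1']
        linarith
      have h3 := monotone_logProfile hf hpos hlow (Real.log_le_log hz0 hle)
      have h4 : (r ^ 2 - ‖z - x₀‖ ^ 2) ^ 2 ≤ r ^ 4 :=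
        (pow_le_pow_left₀ hdz.le (sub_le_self _ (sq_nonneg _)) 2).trans_eq (by ring)
      calc (r ^ 2 - ‖z - x₀‖ ^ 2) ^ 2 * Q z
          ≤ r ^ 4 * (C * logProfile f (Real.log (θ / (1 - θ) * ε))) :=
            mul_le_mul h4 (h2.trans (mul_le_mul_of_nonneg_left h3 hC.le)) (hQ0 z).le
              (by positivity)
        _ ≤ _ := by
          have : 0 ≤ C * ((24 + 4 * n) * r ^ 2) := by positivity
          linarith
  intro x hx
  rw [hQeq x hx, ← logProfile_log f hLε]
  refine (hmax x hx).trans ?_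
  have h5 : (u z + ε) ^ (-β) ≤ ε ^ (-β) :=
    Real.rpow_le_rpow_of_nonpos hε (by linarith [hu0 z hz']) (by linarith)
  calc (r ^ 2 - ‖z - x₀‖ ^ 2) ^ 2 * ((u z + ε) ^ (-β) * Q z)
      = (u z + ε) ^ (-β) * ((r ^ 2 - ‖z - x₀‖ ^ 2) ^ 2 * Q z) := by ring
    _ ≤ ε ^ (-β) * (C * ((24 + 4 * n) * r ^ 2
          + r ^ 4 * logProfile f (Real.log (θ / (1 - θ) * ε)))) :=
        mul_le_mul h5 key (mul_nonneg (sq_nonneg _) (hQ0 z).le) (Real.rpow_nonneg hε.le _)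
    _ = _ := by ring

end Estimate

/-- weak form of the logarithmic gradient and universal boundedness
estimate (Theorem 1.3(I), Euclidean case, n ≥ 4) for `Λ₀ ∈ [p(n), p_S(n))`. -/
theorem stmt11 (n : ℕ) (hn : 4 ≤ n) (Λ₀ : ℝ)
    (hΛ1 : ((n : ℝ) + 3) / ((n : ℝ) - 1) ≤ Λ₀)
    (hΛ2 : Λ₀ < ((n : ℝ) + 2) / ((n : ℝ) - 2)) :
    ∃ β L C : ℝ, 0 < β ∧ 0 < L ∧ 0 < C ∧
      ∀ f : ℝ → ℝ, ContDiffOn ℝ 2 f (Ioi 0) →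
        (∀ t : ℝ, 0 < t → 0 < f t) →
        (∀ t : ℝ, 0 < t → 1 ≤ t * deriv f t / f t) →
        (∀ t : ℝ, 0 < t → t * deriv f t / f t ≤ Λ₀) →
        (∀ s t : ℝ, 0 < s → s ≤ t → s * deriv f s / f s ≤ t * deriv f t / f t) →
        ∀ (x₀ : E n) (R : ℝ), 0 < R →
          ∀ u : E n → ℝ, ContDiffOn ℝ 2 u (ball x₀ (2 * R)) →
            (∀ x ∈ ball x₀ (2 * R), 0 < u x) →
            (∀ x ∈ ball x₀ (2 * R), lap u x + f (u x) = 0) →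
            ∀ ε : ℝ, 0 < ε → ∀ x ∈ ball x₀ R,
              (u x + ε) ^ (-β) * (‖gradient u x‖ ^ 2 / (u x) ^ 2 + f (u x) / u x)
                ≤ C * ε ^ (-β) * (1 / R ^ 2 + f (L * ε) / ε) := by
  have hn' : (4 : ℝ) ≤ n := by exact_mod_cast hn
  have hΛ : 1 ≤ Λ₀ := by
    refine le_trans ?_ hΛ1
    rw [le_div_iff₀ (by linarith)]
    linarith
  obtain ⟨β, L, C, hβ, hL, hC, H⟩ := exists_weighted_bernstein_le hn hΛ hΛ2
  refine ⟨β, L, 2 * C * ((24 + 4 * n) * (9 / 4) + 81 / 16 / L), hβ, hL, by positivity, ?_⟩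
  intro f hf hpos hlow hup hmono x₀ R hR u hu hu0 hsol ε hε x hx
  have hsub : closedBall x₀ (3 / 2 * R) ⊆ ball x₀ (2 * R) := closedBall_subset_ball (by linarith)
  have hxr : x ∈ closedBall x₀ (3 / 2 * R) :=
    closedBall_subset_closedBall (by linarith) (ball_subset_closedBall hx)
  have h := H f hf hpos hlow hup hmono x₀ (3 / 2 * R) (by positivity) u
    (fun y hy => hu.contDiffAt (isOpen_ball.mem_nhds (hsub hy))) (fun y hy => hu0 y (hsub hy))
    (fun y hy => hsol y (hsub hy)) ε hε x hxr
  have hux := hu0 x (hsub hxr)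
  have hg : 0 < f (u x) / u x := div_pos (hpos _ hux) hux
  have hT : 0 < (u x + ε) ^ (-β) := Real.rpow_pos_of_pos (by linarith) _
  have hS : 0 < ε ^ (-β) := Real.rpow_pos_of_pos hε _
  have hK : 0 < f (L * ε) / ε := div_pos (hpos _ (mul_pos hL hε)) hε
  have hR4 : R ^ 4 ≤ ((3 / 2 * R) ^ 2 - ‖x - x₀‖ ^ 2) ^ 2 := by
    rw [mem_ball, dist_eq_norm] at hx
    have h1 : R ^ 2 ≤ (3 / 2 * R) ^ 2 - ‖x - x₀‖ ^ 2 := by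
      nlinarith [norm_nonneg (x - x₀)]
    exact (by ring : R ^ 4 = (R ^ 2) ^ 2).trans_le (pow_le_pow_left₀ (sq_nonneg R) h1 2)
  have ha : 1 / 2 ≤ ((n : ℝ) - 2) / n := by
    rw [le_div_iff₀ (by linarith)]
    linarith
  have hQ : 0 ≤ ‖gradient u x‖ ^ 2 / u x ^ 2 := by positivity
  have hLHS : R ^ 4 * ((u x + ε) ^ (-β) *
      ((‖gradient u x‖ ^ 2 / u x ^ 2 + f (u x) / u x) / 2)) ≤
      ((3 / 2 * R) ^ 2 - ‖x - x₀‖ ^ 2) ^ 2 * ((u x + ε) ^ (-β) *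
        (‖gradient u x‖ ^ 2 / u x ^ 2 + ((n : ℝ) - 2) / n * (f (u x) / u x))) := by
    have h2 := mul_le_mul_of_nonneg_right ha hg.le
    gcongr
    linarith
  have hRHS : (24 + 4 * (n : ℝ)) * (3 / 2 * R) ^ 2 + (3 / 2 * R) ^ 4 * (f (L * ε) / (L * ε)) ≤
      R ^ 4 * (((24 + 4 * n) * (9 / 4) + 81 / 16 / L) * (1 / R ^ 2 + f (L * ε) / ε)) := by
    have e : R ^ 4 * (((24 + 4 * n) * (9 / 4) + 81 / 16 / L) * (1 / R ^ 2 + f (L * ε) / ε)) =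
        (24 + 4 * (n : ℝ)) * (3 / 2 * R) ^ 2 + (3 / 2 * R) ^ 4 * (f (L * ε) / (L * ε)) +
        (R ^ 4 * ((24 + 4 * n) * (9 / 4) * (f (L * ε) / ε)) + R ^ 2 * (81 / 16 / L)) := by
      field_simp
      ring
    rw [e]
    exact le_add_of_nonneg_right (by positivity)
  have h3 := (hLHS.trans h).trans
    (mul_le_mul_of_nonneg_left hRHS (mul_nonneg hC.le hS.le))
  refine le_of_mul_le_mul_left ?_ (by positivity : (0 : ℝ) < R ^ 4)
  linarith
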